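/- arXiv:2305.03821 — 5 statements merged into one kernel-verified Lean document; each statement's English description precedes it below -/
import Mathlib

section
/- Let p_n denote the n-th prime (p_1 = 2, p_2 = 3, p_3 = 5, ...). Let g > 1 and h ≥ 1 be integers with h < g, let c_1, ..., c_g be nonnegative integers (not necessarily distinct), and let d_1, ..., d_h be positive integers (not necessarily distinct). Then there exists a positive integer N such that for all n ≥ N (with n > max_i c_i so every index is at least 1), p_{n-c_1} + p_{n-c_2} + ... + p_{n-c_g} > p_{n+d_1} + ... + p_{n+d_h}. -/
/-- The n-th prime, 1-indexed: `nthPrime 1 = 2`, `nthPrime 2 = 3`, ... -/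
noncomputable def nthPrime (n : ℕ) : ℕ := Nat.nth Nat.Prime (n - 1)


open Complex in
theorem exists_H : ∃ H : ℂ → ℂ, ContinuousOn H {s | 1 ≤ s.re} ∧ ∀ s : ℂ, 1 < s.re →
    LSeriesHasSum (fun n => ((ArithmeticFunction.vonMangoldt n - 1 : ℝ) : ℂ)) s (H s) := by
  refine ⟨fun s => ArithmeticFunction.vonMangoldt.LFunctionResidueClassAux (1 : ZMod 1) s -
    dslope (DirichletCharacter.LFunctionTrivChar₁ 1) 1 s, ?_, ?_⟩
  · apply (ArithmeticFunction.vonMangoldt.continuousOn_LFunctionResidueClassAux (1 : ZMod 1)).sub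
    apply ContinuousOn.mono _ (Set.subset_univ _)
    apply DifferentiableOn.continuousOn (𝕜 := ℂ)
    rw [Complex.differentiableOn_dslope Filter.univ_mem]
    exact (DirichletCharacter.differentiable_LFunctionTrivChar₁ 1).differentiableOn
  · intro s hs
    have hs1 : s ≠ 1 := by rintro rfl; simp at hs
    have hs1' : s - 1 ≠ 0 := sub_ne_zero.2 hs1
    have h1 : LSeriesHasSum (fun n => (ArithmeticFunction.vonMangoldt n : ℂ)) s _ :=
      (ArithmeticFunction.LSeriesSummable_vonMangoldt hs).LSeriesHasSum
    have h2 := LSeriesHasSum_one hs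
    have h3 := h1.sub h2
    have e1 : (fun n => ((ArithmeticFunction.vonMangoldt n - 1 : ℝ) : ℂ)) =
      (fun n => (ArithmeticFunction.vonMangoldt n : ℂ)) - 1 := by
      ext n; simp
    rw [e1]
    convert h3 using 1
    have h4 := ArithmeticFunction.vonMangoldt.eqOn_LFunctionResidueClassAux (a := (1 : ZMod 1)) isUnit_one hs
    beta_reduce at h4 ⊢
    rw [h4, dslope_of_ne _ hs1, slope_def_field]
    have e2 : (fun n => (ArithmeticFunction.vonMangoldt.residueClass (1 : ZMod 1) n : ℂ)) =
      (fun n => (ArithmeticFunction.vonMangoldt n : ℂ)) := by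
      ext n
      simp [ArithmeticFunction.vonMangoldt.residueClass, Set.indicator_apply, Subsingleton.elim ((n : ZMod 1)) 1]
    rw [e2]
    simp only [DirichletCharacter.LFunctionTrivChar₁, Function.update_self, Function.update_of_ne hs1]
    have e3 : DirichletCharacter.LFunctionTrivChar 1 s = riemannZeta s := by
      simp
    rw [e3]
    simp
    field_simp
    ring

noncomputable def WK (T y : ℝ) : ℝ := ∫ t in (0:ℝ)..T, 2 * (1 - t / T) * Real.cos (t * y)

theorem WK_formula {T y : ℝ} (hT : 0 < T) (hy : y ≠ 0) :
    WK T y = 2 * (1 - Real.cos (T * y)) / (T * y ^ 2) := by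
  unfold WK
  have hT' := hT.ne'
  rw [intervalIntegral.integral_eq_sub_of_hasDerivAt
    (f := fun t => 2 * (1 - t / T) * (Real.sin (t * y) / y) - 2 * Real.cos (t * y) / (T * y ^ 2))]
  · simp
    field_simp
    ring
  · intro t _
    have h1 : HasDerivAt (fun t : ℝ => t * y) y t := by simpa using (hasDerivAt_id t).mul_const y
    have h2 : HasDerivAt (fun t : ℝ => 2 * (1 - t / T)) (2 * (-(1 / T))) t := by
      simpa using (((hasDerivAt_id t).div_const T).const_sub 1).const_mul 2
    refine ((h2.mul (h1.sin.div_const y)).sub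
      ((h1.cos.const_mul 2).div_const (T * y ^ 2))).congr_deriv ?_
    field_simp
    ring
  · apply Continuous.intervalIntegrable
    fun_prop

theorem WK_zero {T : ℝ} (hT : 0 < T) : WK T 0 = T := by
  unfold WK
  have hT' := hT.ne'
  rw [intervalIntegral.integral_eq_sub_of_hasDerivAt
    (f := fun t => 2 * (t - t ^ 2 / (2 * T)))]
  · field_simp; ring
  · intro t _
    refine (((hasDerivAt_id t).sub
      (((hasDerivAt_id t).pow 2).div_const (2 * T))).const_mul 2).congr_deriv ?_
    simp
    field_simp
  · apply Continuous.intervalIntegrable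
    fun_prop

theorem WK_nonneg {T : ℝ} (hT : 0 < T) (y : ℝ) : 0 ≤ WK T y := by
  by_cases hy : y = 0
  · rw [hy, WK_zero hT]; exact hT.le
  · rw [WK_formula hT hy]
    have := Real.cos_le_one (T * y)
    have : 0 ≤ 1 - Real.cos (T * y) := by linarith
    positivity

theorem WK_le {T : ℝ} (hT : 0 < T) (y : ℝ) : WK T y ≤ T := by
  by_cases hy : y = 0
  · rw [hy, WK_zero hT]
  · rw [WK_formula hT hy]
    have := Real.one_sub_sq_div_two_le_cos (x := T * y)
    rw [div_le_iff₀ (by positivity)]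
    nlinarith

theorem WK_le' {T : ℝ} (hT : 0 < T) {y : ℝ} (hy : y ≠ 0) : WK T y ≤ 4 / (T * y ^ 2) := by
  rw [WK_formula hT hy]
  have := Real.neg_one_le_cos (T * y)
  gcongr
  linarith

theorem WK_ge {T : ℝ} (hT : 0 < T) {y : ℝ} (hy : |T * y| ≤ 1) : T / 2 ≤ WK T y := by
  by_cases hy0 : y = 0
  · rw [hy0, WK_zero hT]; linarith
  · rw [WK_formula hT hy0]
    have h := (abs_le.1 (Real.cos_bound hy)).2
    have h2 : |T * y| ^ 4 ≤ (T * y) ^ 2 := by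
      rw [← sq_abs (T * y)]
      exact pow_le_pow_of_le_one (abs_nonneg _) hy (by norm_num)
    rw [le_div_iff₀ (by positivity)]
    nlinarith [sq_nonneg (T * y)]

open Complex in
theorem re_term (b : ℕ → ℝ) (n : ℕ) {σ : ℝ} (hσ : 1 < σ) (t u : ℝ) :
    (cexp (t * u * I) * LSeries.term (fun n => (b n : ℂ)) (σ + t * I) n).re =
      b n * (n : ℝ) ^ (-σ) * Real.cos (t * (Real.log n - u)) := by
  rcases Nat.eq_zero_or_pos n with rfl | hn
  · simp [Real.zero_rpow (by linarith : -σ ≠ 0)]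
  · have hn' : (0:ℝ) < n := by exact_mod_cast hn
    rw [LSeries.term_of_ne_zero hn.ne']
    have : (n : ℂ) ^ ((σ : ℂ) + t * I) = (((n : ℝ) ^ σ : ℝ) : ℂ) * cexp (t * Real.log n * I) := by
      rw [Complex.cpow_add _ _ (by exact_mod_cast hn.ne'), Complex.ofReal_cpow hn'.le]
      congr 1
      rw [Complex.cpow_def_of_ne_zero (by exact_mod_cast hn.ne')]
      rw [Complex.ofReal_log hn'.le]
      push_cast
      ring_nf
    rw [this, div_eq_mul_inv, mul_inv, ← Complex.exp_neg, ← Complex.ofReal_inv, ← Real.rpow_neg hn'.le]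
    have : cexp (t * u * I) * ((b n : ℂ) * (((n : ℝ) ^ (-σ) : ℝ) * cexp (-(t * Real.log n * I))))
      = ((b n * (n : ℝ) ^ (-σ) : ℝ) : ℂ) * cexp ((-(t * (Real.log n - u)) : ℝ) * I) := by
      rw [show (((-(t * (Real.log n - u)) : ℝ) : ℂ) * I) = t * u * I + -(t * Real.log n * I) by
        push_cast; ring, Complex.exp_add]
      push_cast
      ring
    rw [this, Complex.re_ofReal_mul, Complex.exp_ofReal_mul_I_re, Real.cos_neg]

open Complex in
theorem smooth_id (b : ℕ → ℝ) (H : ℂ → ℂ)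
    (hH : ∀ s : ℂ, 1 < s.re → LSeriesHasSum (fun n => (b n : ℂ)) s (H s))
    {σ T u : ℝ} (hσ : 1 < σ) (hT : 0 < T) :
    HasSum (fun n : ℕ => b n * (n : ℝ) ^ (-σ) * WK T (Real.log n - u))
      (∫ t in (0:ℝ)..T, 2 * (1 - t / T) * (cexp (t * u * I) * H (σ + t * I)).re) := by
  have e : ∀ n : ℕ, b n * (n : ℝ) ^ (-σ) * WK T (Real.log n - u) =
      ∫ t in (0:ℝ)..T, 2 * (1 - t / T) * (b n * (n : ℝ) ^ (-σ) * Real.cos (t * (Real.log n - u))) := by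
    intro n
    rw [WK, ← intervalIntegral.integral_const_mul]
    congr 1; ext t; ring
  simp_rw [e]
  have hsum : Summable (fun n : ℕ => |b n * (n : ℝ) ^ (-σ)|) := by
    have h0 := (hH σ (by simpa using hσ)).summable.norm
    refine h0.congr ?_
    intro n
    rcases Nat.eq_zero_or_pos n with rfl | hn
    · simp [Real.zero_rpow (by linarith : -σ ≠ 0)]
    · have hn' : (0:ℝ) < n := by exact_mod_cast hn
      rw [LSeries.norm_term_eq, if_neg hn.ne', abs_mul, Real.rpow_neg hn'.le, abs_inv,
        abs_of_pos (Real.rpow_pos_of_pos hn' _)]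
      simp [div_eq_mul_inv]
  apply intervalIntegral.hasSum_integral_of_dominated_convergence
    (fun n _ => 2 * |b n * (n : ℝ) ^ (-σ)|)
  · intro n
    apply Continuous.aestronglyMeasurable
    fun_prop
  · intro n
    refine Filter.Eventually.of_forall fun t ht => ?_
    rw [Set.uIoc_of_le hT.le] at ht
    have h1 : t / T ≤ 1 := (div_le_one hT).2 ht.2
    have h2 : 0 ≤ t / T := div_nonneg ht.1.le hT.le
    rw [Real.norm_eq_abs, abs_mul, abs_mul (b n * _)]
    have h3 : |2 * (1 - t / T)| ≤ 2 := by rw [abs_le]; constructor <;> linarith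
    have h4 := Real.abs_cos_le_one (t * (Real.log n - u))
    calc _ ≤ 2 * (|b n * (n : ℝ) ^ (-σ)| * 1) := by gcongr
      _ = _ := by ring
  · exact Filter.Eventually.of_forall fun t _ => hsum.mul_left 2
  · exact intervalIntegrable_const
  · refine Filter.Eventually.of_forall fun t _ => ?_
    apply HasSum.mul_left
    have h := (hH (σ + t * I) (by simpa using hσ)).mul_left (cexp (t * u * I))
    have h' := Complex.hasSum_re h
    simp_rw [re_term b _ hσ] at h'
    exact h'

open Chebyshev in
theorem block_one (v : ℝ) (s : Finset ℕ) (hs : ∀ n ∈ s, 0 < n ∧ v ≤ Real.log n ∧ Real.log n ≤ v + 1) :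
    ∑ n ∈ s, ArithmeticFunction.vonMangoldt n * (n : ℝ)⁻¹ ≤ (Real.log 4 + 4) * Real.exp 1 := by
  have h1 : ∑ n ∈ s, ArithmeticFunction.vonMangoldt n ≤ psi (Real.exp (v + 1)) := by
    rw [psi]
    apply Finset.sum_le_sum_of_subset_of_nonneg
    · intro n hn
      obtain ⟨h0, h1, h2⟩ := hs n hn
      rw [Finset.mem_Ioc]
      refine ⟨h0, Nat.le_floor ?_⟩
      exact (Real.log_le_iff_le_exp (by exact_mod_cast h0)).1 h2
    · intros; exact ArithmeticFunction.vonMangoldt_nonneg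
  have h2 := psi_le_const_mul_self (Real.exp_pos (v + 1)).le
  calc _ ≤ ∑ n ∈ s, ArithmeticFunction.vonMangoldt n * (Real.exp v)⁻¹ := by
        apply Finset.sum_le_sum
        intro n hn
        obtain ⟨h0, h1, h2⟩ := hs n hn
        have := (Real.le_log_iff_exp_le (by exact_mod_cast h0)).1 h1
        have h3 := ArithmeticFunction.vonMangoldt_nonneg (n := n)
        gcongr
    _ = (∑ n ∈ s, ArithmeticFunction.vonMangoldt n) * (Real.exp v)⁻¹ := by rw [Finset.sum_mul]
    _ ≤ ((Real.log 4 + 4) * Real.exp (v + 1)) * (Real.exp v)⁻¹ := by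
        gcongr; linarith
    _ = _ := by
        rw [Real.exp_add]
        have := (Real.exp_pos v).ne'
        field_simp

theorem summable_int : Summable (fun k : ℤ => 1 / (1 + (k : ℝ) ^ 2)) := by
  refine Summable.of_norm_bounded_eventually
    (Real.summable_one_div_int_pow (p := 2).2 (by norm_num)) ?_
  have : ∀ᶠ k : ℤ in Filter.cofinite, k ≠ 0 := by
    rw [Filter.eventually_cofinite]; simp
  filter_upwards [this] with k hk
  have hk' : (k : ℝ) ≠ 0 := by exact_mod_cast hk
  rw [Real.norm_of_nonneg (by positivity)]
  gcongr
  linarith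

theorem block_bound : ∃ B : ℝ, 0 < B ∧ ∀ (u : ℝ) (s : Finset ℕ), (∀ n ∈ s, 0 < n) →
    ∑ n ∈ s, ArithmeticFunction.vonMangoldt n * (n : ℝ)⁻¹ * (1 / (1 + (Real.log n - u) ^ 2)) ≤ B := by
  have hC : 0 < (Real.log 4 + 4) * Real.exp 1 := by
    have := Real.log_pos (show (1:ℝ) < 4 by norm_num)
    positivity
  refine ⟨(Real.log 4 + 4) * Real.exp 1 * 3 * ∑' k : ℤ, 1 / (1 + (k : ℝ) ^ 2), ?_, ?_⟩
  · have : 0 < ∑' k : ℤ, 1 / (1 + (k : ℝ) ^ 2) :=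
      summable_int.tsum_pos (fun k => by positivity) 0 (by positivity)
    positivity
  · intro u s hs
    rw [← Finset.sum_fiberwise_of_maps_to (t := s.image (fun n : ℕ => ⌊Real.log n - u⌋))
      (g := fun n : ℕ => ⌊Real.log n - u⌋) (fun n hn => Finset.mem_image_of_mem _ hn)]
    calc _ ≤ ∑ k ∈ s.image (fun n : ℕ => ⌊Real.log n - u⌋),
          (Real.log 4 + 4) * Real.exp 1 * 3 * (1 / (1 + (k : ℝ) ^ 2)) := by
          apply Finset.sum_le_sum
          intro k _
          have h1 := block_one (u + k) (s.filter (fun n : ℕ => ⌊Real.log n - u⌋ = k)) (by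
            intro n hn
            rw [Finset.mem_filter, Int.floor_eq_iff] at hn
            exact ⟨hs n hn.1, by linarith [hn.2.1], by linarith [hn.2.2]⟩)
          calc _ ≤ ∑ n ∈ s.filter (fun n : ℕ => ⌊Real.log n - u⌋ = k),
                ArithmeticFunction.vonMangoldt n * (n : ℝ)⁻¹ * (3 * (1 / (1 + (k : ℝ) ^ 2))) := by
                apply Finset.sum_le_sum
                intro n hn
                rw [Finset.mem_filter, Int.floor_eq_iff] at hn
                have h3 := ArithmeticFunction.vonMangoldt_nonneg (n := n)
                gcongr
                rw [mul_one_div, div_le_div_iff₀ (by positivity) (by positivity)]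
                nlinarith [hn.2.1, hn.2.2, sq_nonneg (2 * (Real.log n - u) - k)]
            _ ≤ _ := by
                rw [← Finset.sum_mul, mul_assoc]
                gcongr
      _ ≤ _ := by
          rw [← Finset.mul_sum]
          gcongr
          exact summable_int.sum_le_tsum _ (fun k _ => by positivity)
open Complex in
theorem R_cont (H : ℂ → ℂ) (hH : ContinuousOn H {s | 1 ≤ s.re}) (T u : ℝ) :
    Filter.Tendsto (fun σ : ℝ => ∫ t in (0:ℝ)..T, 2 * (1 - t / T) * (cexp (t * u * I) * H (σ + t * I)).re)
      (nhdsWithin 1 (Set.Ioi 1))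
      (nhds (∫ t in (0:ℝ)..T, 2 * (1 - t / T) * (cexp (t * u * I) * H (1 + t * I)).re)) := by
  have hc : Continuous (fun p : ℝ × ℝ => H ((max p.1 1 : ℝ) + p.2 * I)) := by
    apply hH.comp_continuous (by fun_prop)
    intro p
    simp
  have h2 : Continuous (fun σ : ℝ => ∫ t in (0:ℝ)..T, 2 * (1 - t / T) *
      (cexp (t * u * I) * H ((max σ 1 : ℝ) + t * I)).re) := by
    apply intervalIntegral.continuous_parametric_intervalIntegral_of_continuous'
    have : Continuous (fun p : ℝ × ℝ => 2 * (1 - p.2 / T) *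
      (cexp (p.2 * u * I) * H ((max p.1 1 : ℝ) + p.2 * I)).re) := by
      apply Continuous.mul (by fun_prop)
      apply Complex.continuous_re.comp
      exact Continuous.mul (by fun_prop) hc
    exact this
  have h3 := (h2.tendsto 1).mono_left (nhdsWithin_le_nhds (s := Set.Ioi 1))
  simp only [max_self, Complex.ofReal_one] at h3
  refine h3.congr' ?_
  filter_upwards [self_mem_nhdsWithin] with σ hσ
  rw [max_eq_left (le_of_lt hσ)]

open Complex in
theorem R_RL (H : ℂ → ℂ) (hH : ContinuousOn H {s | 1 ≤ s.re}) {T : ℝ} (hT : 0 < T) :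
    Filter.Tendsto (fun u : ℝ => ∫ t in (0:ℝ)..T, 2 * (1 - t / T) * (cexp (t * u * I) * H (1 + t * I)).re)
      Filter.atTop (nhds 0) := by
  have hc : Continuous (fun t : ℝ => H (1 + t * I)) := by
    apply hH.comp_continuous (by fun_prop)
    intro p
    simp
  have h1 := Real.tendsto_integral_exp_smul_cocompact
    (Set.indicator (Set.Ioc 0 T) (fun t : ℝ => (((2 * (1 - t / T) : ℝ)) : ℂ) * H (1 + t * I)))
  have h2 : Filter.Tendsto (fun u : ℝ => -u / (2 * Real.pi)) Filter.atTop (Filter.cocompact ℝ) := by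
    rw [cocompact_eq_atBot_atTop]
    refine Filter.Tendsto.mono_right ?_ le_sup_left
    exact Filter.tendsto_neg_atTop_atBot.atBot_div_const (by positivity)
  have h3 := (Complex.continuous_re.tendsto _).comp (h1.comp h2)
  simp only [Complex.zero_re] at h3
  refine h3.congr ?_
  intro u
  simp only [Function.comp]
  have e : (∫ v : ℝ, Real.fourierChar (-(v * (-u / (2 * Real.pi)))) •
      Set.indicator (Set.Ioc 0 T) (fun t : ℝ => (((2 * (1 - t / T) : ℝ)) : ℂ) * H (1 + t * I)) v)
      = ∫ t in Set.Ioc 0 T, (((2 * (1 - t / T) : ℝ)) : ℂ) * (cexp (t * u * I) * H (1 + t * I)) := by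
    rw [← MeasureTheory.integral_indicator measurableSet_Ioc]
    congr 1
    ext v
    by_cases hv : v ∈ Set.Ioc 0 T
    · rw [Set.indicator_of_mem hv, Set.indicator_of_mem hv, Circle.smul_def, Real.fourierChar_apply]
      have : ((2 * Real.pi * -(v * (-u / (2 * Real.pi))) : ℝ) : ℂ) * I = v * u * I := by
        have := Real.pi_pos.ne'
        rw [show (2 * Real.pi * -(v * (-u / (2 * Real.pi)))) = v * u by field_simp]
        push_cast; ring
      rw [this, smul_eq_mul]
      ring
    · rw [Set.indicator_of_notMem hv, Set.indicator_of_notMem hv, smul_zero]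
  rw [e, intervalIntegral.integral_of_le hT.le]
  have hi : MeasureTheory.IntegrableOn (fun t : ℝ => (((2 * (1 - t / T) : ℝ)) : ℂ) * (cexp (t * u * I) * H (1 + t * I))) (Set.Ioc 0 T) := by
    apply Continuous.integrableOn_Ioc
    exact Continuous.mul (by fun_prop) (Continuous.mul (by fun_prop) hc)
  have := reCLM.integral_comp_comm hi
  simp only [reCLM_apply] at this
  rw [← this]
  congr 1
  ext t
  rw [Complex.re_ofReal_mul]

open Chebyshev in
theorem upper_bound {B C : ℝ} (hB : ∀ (u : ℝ) (s : Finset ℕ), (∀ n ∈ s, 0 < n) →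
    ∑ n ∈ s, ArithmeticFunction.vonMangoldt n * (n : ℝ)⁻¹ * (1 / (1 + (Real.log n - u) ^ 2)) ≤ B)
    (hC : ∀ x, psi x - theta x ≤ C * x.sqrt) {δ T u σ : ℝ} (hδ : 0 < δ) (hT : 0 < T) (hσ : 1 < σ)
    (hgap : ∀ p : ℕ, p.Prime → u - δ < Real.log p → Real.log p < u + δ → False) (s : Finset ℕ) :
    ∑ n ∈ s, ArithmeticFunction.vonMangoldt n * (n : ℝ) ^ (-σ) * WK T (Real.log n - u) ≤
      4 / T * (1 + 1 / δ ^ 2) * B +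
      T * (Real.exp (u - δ))⁻¹ * (C * (Real.exp (u + δ)).sqrt) := by
  have h0 : ∑ n ∈ s, ArithmeticFunction.vonMangoldt n * (n : ℝ) ^ (-σ) * WK T (Real.log n - u) =
      ∑ n ∈ s.filter (fun n => 0 < n),
        ArithmeticFunction.vonMangoldt n * (n : ℝ) ^ (-σ) * WK T (Real.log n - u) := by
    rw [Finset.sum_filter_of_ne]
    intro n _ hne
    rcases Nat.eq_zero_or_pos n with rfl | h
    · simp at hne
    · exact h
  rw [h0]
  set s' := s.filter (fun n => 0 < n) with hs'
  have hpos : ∀ n ∈ s', 0 < n := fun n hn => (Finset.mem_filter.1 hn).2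
  have h1 : ∑ n ∈ s', ArithmeticFunction.vonMangoldt n * (n : ℝ) ^ (-σ) * WK T (Real.log n - u) ≤
      ∑ n ∈ s', ArithmeticFunction.vonMangoldt n * (n : ℝ)⁻¹ * WK T (Real.log n - u) := by
    apply Finset.sum_le_sum
    intro n hn
    have hn1 : (1 : ℝ) ≤ n := by exact_mod_cast hpos n hn
    have h3 := ArithmeticFunction.vonMangoldt_nonneg (n := n)
    have h4 := WK_nonneg hT (Real.log n - u)
    have h5 : (n : ℝ) ^ (-σ) ≤ (n : ℝ)⁻¹ := by
      rw [← Real.rpow_neg_one]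
      exact Real.rpow_le_rpow_of_exponent_le hn1 (by linarith)
    gcongr
  refine h1.trans ?_
  rw [← Finset.sum_filter_not_add_sum_filter s' (fun n : ℕ => u - δ < Real.log n ∧ Real.log n < u + δ)]
  apply add_le_add
  · calc _ ≤ ∑ n ∈ s'.filter (fun n : ℕ => ¬ (u - δ < Real.log n ∧ Real.log n < u + δ)),
        (4 / T * (1 + 1 / δ ^ 2)) * (ArithmeticFunction.vonMangoldt n * (n : ℝ)⁻¹ *
          (1 / (1 + (Real.log n - u) ^ 2))) := by
          apply Finset.sum_le_sum
          intro n hn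
          rw [Finset.mem_filter] at hn
          have h3 := ArithmeticFunction.vonMangoldt_nonneg (n := n)
          have hy : δ ≤ |Real.log n - u| := by
            by_contra hlt
            rw [not_le, abs_lt] at hlt
            exact hn.2 ⟨by linarith, by linarith⟩
          have hy0 : Real.log n - u ≠ 0 := by
            intro h; rw [h, abs_zero] at hy; linarith
          have hy2 : δ ^ 2 ≤ (Real.log n - u) ^ 2 := by
            rw [← sq_abs (Real.log n - u)]; gcongr
          have h6 : WK T (Real.log n - u) ≤ (4 / T * (1 + 1 / δ ^ 2)) * (1 / (1 + (Real.log n - u) ^ 2)) := by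
            refine (WK_le' hT hy0).trans ?_
            set y := Real.log n - u
            have : 1 / y ^ 2 ≤ (1 + 1 / δ ^ 2) * (1 / (1 + y ^ 2)) := by
              rw [mul_one_div, div_le_div_iff₀ (by positivity) (by positivity)]
              have : 1 ≤ 1 / δ ^ 2 * y ^ 2 := by
                rw [one_div, inv_mul_eq_div, one_le_div (by positivity)]; exact hy2
              nlinarith
            calc 4 / (T * y ^ 2) = 4 / T * (1 / y ^ 2) := by field_simp
              _ ≤ 4 / T * ((1 + 1 / δ ^ 2) * (1 / (1 + y ^ 2))) := by gcongr
              _ = _ := by ring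
          calc _ ≤ ArithmeticFunction.vonMangoldt n * (n : ℝ)⁻¹ * ((4 / T * (1 + 1 / δ ^ 2)) * (1 / (1 + (Real.log n - u) ^ 2))) := by gcongr
            _ = _ := by ring
      _ ≤ _ := by
          rw [← Finset.mul_sum]
          gcongr
          exact hB u _ (fun n hn => hpos n (Finset.mem_filter.1 hn).1)
  · calc _ ≤ ∑ n ∈ s'.filter (fun n : ℕ => (u - δ < Real.log n ∧ Real.log n < u + δ)),
        T * (Real.exp (u - δ))⁻¹ * ArithmeticFunction.vonMangoldt n := by
          apply Finset.sum_le_sum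
          intro n hn
          rw [Finset.mem_filter] at hn
          have h3 := ArithmeticFunction.vonMangoldt_nonneg (n := n)
          have hn0 : (0 : ℝ) < n := by exact_mod_cast hpos n hn.1
          have := (Real.lt_log_iff_exp_lt hn0).1 hn.2.1
          have h4 := WK_nonneg hT (Real.log n - u)
          calc _ ≤ ArithmeticFunction.vonMangoldt n * (Real.exp (u - δ))⁻¹ * T := by
                gcongr
                exact WK_le hT _
            _ = _ := by ring
      _ ≤ T * (Real.exp (u - δ))⁻¹ * (psi (Real.exp (u + δ)) - theta (Real.exp (u + δ))) := by
          rw [← Finset.mul_sum]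
          gcongr
          rw [psi_sub_theta_eq_sum_not_prime]
          apply Finset.sum_le_sum_of_subset_of_nonneg
          · intro n hn
            rw [Finset.mem_filter] at hn
            have hn0 : (0 : ℝ) < n := by exact_mod_cast hpos n hn.1
            rw [Finset.mem_filter, Finset.mem_Ioc]
            exact ⟨⟨hpos n hn.1, Nat.le_floor ((Real.log_lt_iff_lt_exp hn0).1 hn.2.2).le⟩,
              fun hp => hgap n hp hn.2.1 hn.2.2⟩
          · intros; exact ArithmeticFunction.vonMangoldt_nonneg
      _ ≤ _ := by
          gcongr
          exact hC _

theorem lower_bound {T u : ℝ} (hT : 1 ≤ T) :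
    1 / 4 - T / 2 * Real.exp (-u) ≤ ∑ n ∈ Finset.Ioc ⌊Real.exp u⌋₊ ⌊Real.exp (u + 1 / T)⌋₊,
      (n : ℝ) ^ (-1 : ℝ) * WK T (Real.log n - u) := by
  have hT0 : 0 < T := by linarith
  have hTi : 0 < 1 / T := by positivity
  have hTi1 : 1 / T ≤ 1 := by rw [div_le_one hT0]; exact hT
  have h1 : ∑ n ∈ Finset.Ioc ⌊Real.exp u⌋₊ ⌊Real.exp (u + 1 / T)⌋₊,
      (Real.exp (u + 1 / T))⁻¹ * (T / 2) ≤ ∑ n ∈ Finset.Ioc ⌊Real.exp u⌋₊ ⌊Real.exp (u + 1 / T)⌋₊,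
      (n : ℝ) ^ (-1 : ℝ) * WK T (Real.log n - u) := by
    apply Finset.sum_le_sum
    intro n hn
    rw [Finset.mem_Ioc] at hn
    have hn0 : (0 : ℝ) < n := by exact_mod_cast (Nat.zero_le _).trans_lt hn.1
    have ha : Real.exp u < n := (Nat.floor_lt (Real.exp_pos _).le).1 hn.1
    have hb : (n : ℝ) ≤ Real.exp (u + 1 / T) := (Nat.le_floor_iff (Real.exp_pos _).le).1 hn.2
    have ha' := (Real.lt_log_iff_exp_lt hn0).2 ha
    have hb' := (Real.log_le_iff_le_exp hn0).2 hb
    rw [Real.rpow_neg_one]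
    have : T / 2 ≤ WK T (Real.log n - u) := by
      apply WK_ge hT0
      rw [abs_of_nonneg (mul_nonneg hT0.le (by linarith))]
      calc T * (Real.log n - u) ≤ T * (1 / T) := by gcongr; linarith
        _ = 1 := by field_simp
    gcongr
  refine le_trans ?_ h1
  rw [Finset.sum_const, Nat.card_Ioc, nsmul_eq_mul]
  have hc : Real.exp (u + 1 / T) - Real.exp u - 1 ≤
      ((⌊Real.exp (u + 1 / T)⌋₊ - ⌊Real.exp u⌋₊ : ℕ) : ℝ) := by
    rw [Nat.cast_sub (Nat.floor_mono (Real.exp_le_exp.2 (by linarith)))]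
    have := Nat.lt_floor_add_one (Real.exp (u + 1 / T))
    have := Nat.floor_le (Real.exp_pos u).le
    linarith
  have h2 : Real.exp (-(1 / T)) ≤ 1 - 1 / T / 2 := by
    have := Real.exp_bound_div_one_sub_of_interval (x := 1 / T) 
    have h3 := Real.add_one_le_exp (1 / T)
    rw [Real.exp_neg]
    refine (inv_anti₀ (by positivity) h3).trans ?_
    rw [inv_le_iff_one_le_mul₀ (by positivity)]
    nlinarith
  have h4 : Real.exp (-u) * Real.exp (-(1 / T)) ≤ Real.exp (-u) := by
    rw [← Real.exp_add]; exact Real.exp_le_exp.2 (by linarith)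
  calc 1 / 4 - T / 2 * Real.exp (-u) = T / 2 * (1 / T / 2 - Real.exp (-u)) := by field_simp; ring
    _ ≤ T / 2 * (1 - Real.exp (-(1 / T)) - Real.exp (-u) * Real.exp (-(1 / T))) := by
        gcongr; linarith
    _ = (Real.exp (u + 1 / T) - Real.exp u - 1) * ((Real.exp (u + 1 / T))⁻¹ * (T / 2)) := by
        rw [Real.exp_add, Real.exp_neg, Real.exp_neg]
        have := (Real.exp_pos u).ne'
        have := (Real.exp_pos (1 / T)).ne'
        field_simp
    _ ≤ _ := by gcongr

theorem gap_log {δ : ℝ} (hδ : 0 < δ) : ∀ᶠ u : ℝ in Filter.atTop,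
    ∃ p : ℕ, p.Prime ∧ u - δ < Real.log p ∧ Real.log p < u + δ := by
  obtain ⟨H, hH, hHs⟩ := exists_H
  obtain ⟨B, hB0, hB⟩ := block_bound
  obtain ⟨C, hC⟩ := Chebyshev.psi_sub_theta_le_mul_sqrt
  obtain ⟨T, hT1, hT2⟩ : ∃ T : ℝ, 1 ≤ T ∧ 4 / T * (1 + 1 / δ ^ 2) * B ≤ 1 / 16 := by
    refine ⟨max 1 (64 * ((1 + 1 / δ ^ 2) * B)), le_max_left _ _, ?_⟩
    have h := le_max_right 1 (64 * ((1 + 1 / δ ^ 2) * B))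
    have h' := le_max_left 1 (64 * ((1 + 1 / δ ^ 2) * B))
    set T := max 1 (64 * ((1 + 1 / δ ^ 2) * B))
    rw [mul_assoc, div_mul_eq_mul_div, div_le_iff₀ (by linarith)]
    linarith
  have hT0 : 0 < T := by linarith
  have l1 := R_RL H hH hT0
  have l2 : Filter.Tendsto (fun u : ℝ => T / 2 * Real.exp (-u)) Filter.atTop (nhds 0) := by
    simpa using (Real.tendsto_exp_neg_atTop_nhds_zero).const_mul (T / 2)
  have l3 : Filter.Tendsto (fun u : ℝ => T * (Real.exp (u - δ))⁻¹ * (C * (Real.exp (u + δ)).sqrt))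
      Filter.atTop (nhds 0) := by
    have h1 : Filter.Tendsto (fun u : ℝ => Real.exp (-(u / 2))) Filter.atTop (nhds 0) :=
      Real.tendsto_exp_neg_atTop_nhds_zero.comp (Filter.tendsto_id.atTop_div_const (by norm_num))
    have h2 := h1.const_mul (T * C * Real.exp (3 * δ / 2))
    rw [mul_zero] at h2
    refine h2.congr fun u => ?_
    rw [Real.sqrt_eq_rpow, ← Real.exp_mul, ← Real.exp_neg]
    have : Real.exp (3 * δ / 2) * Real.exp (-(u / 2)) = Real.exp (-(u - δ)) * Real.exp ((u + δ) * (1 / 2)) := by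
      rw [← Real.exp_add, ← Real.exp_add]; congr 1; ring
    linear_combination (T * C) * this
  filter_upwards [l1.eventually (lt_mem_nhds (show (-(1/32) : ℝ) < 0 by norm_num)),
    l2.eventually (gt_mem_nhds (show (0 : ℝ) < 1/32 by norm_num)),
    l3.eventually (gt_mem_nhds (show (0 : ℝ) < 1/32 by norm_num))] with u h1 h2 h3
  by_contra hno
  have hgap : ∀ p : ℕ, p.Prime → u - δ < Real.log p → Real.log p < u + δ → False :=
    fun p hp ha hb => hno ⟨p, hp, ha, hb⟩
  set I := Finset.Ioc ⌊Real.exp u⌋₊ ⌊Real.exp (u + 1 / T)⌋₊ with hI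
  have key : ∀ σ : ℝ, 1 < σ →
      (∫ t in (0:ℝ)..T, 2 * (1 - t / T) *
        (Complex.exp (t * u * Complex.I) * H (σ + t * Complex.I)).re) ≤
      (4 / T * (1 + 1 / δ ^ 2) * B + T * (Real.exp (u - δ))⁻¹ * (C * (Real.exp (u + δ)).sqrt)) -
        ∑ n ∈ I, (n : ℝ) ^ (-σ) * WK T (Real.log n - u) := by
    intro σ hσ
    have hs := smooth_id (fun n => ArithmeticFunction.vonMangoldt n - 1) H hHs (u := u) hσ hT0
    refine le_of_tendsto hs ?_
    filter_upwards [Filter.eventually_ge_atTop I] with s hIs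
    have e : ∑ n ∈ s, (ArithmeticFunction.vonMangoldt n - 1) * (n : ℝ) ^ (-σ) * WK T (Real.log n - u)
      = ∑ n ∈ s, ArithmeticFunction.vonMangoldt n * (n : ℝ) ^ (-σ) * WK T (Real.log n - u) -
        ∑ n ∈ s, (n : ℝ) ^ (-σ) * WK T (Real.log n - u) := by
      rw [← Finset.sum_sub_distrib]
      apply Finset.sum_congr rfl
      intros; ring
    rw [e]
    apply sub_le_sub
    · exact upper_bound hB hC hδ hT0 hσ hgap s
    · apply Finset.sum_le_sum_of_subset_of_nonneg hIs
      intro n _ _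
      exact mul_nonneg (Real.rpow_nonneg (Nat.cast_nonneg n) _) (WK_nonneg hT0 _)
  have lim1 := R_cont H hH T u
  have lim2 : Filter.Tendsto (fun σ : ℝ => (4 / T * (1 + 1 / δ ^ 2) * B + T * (Real.exp (u - δ))⁻¹ * (C * (Real.exp (u + δ)).sqrt)) -
        ∑ n ∈ I, (n : ℝ) ^ (-σ) * WK T (Real.log n - u)) (nhdsWithin 1 (Set.Ioi 1))
      (nhds ((4 / T * (1 + 1 / δ ^ 2) * B + T * (Real.exp (u - δ))⁻¹ * (C * (Real.exp (u + δ)).sqrt)) -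
        ∑ n ∈ I, (n : ℝ) ^ (-1 : ℝ) * WK T (Real.log n - u))) := by
    refine Filter.Tendsto.mono_left ?_ nhdsWithin_le_nhds
    apply Filter.Tendsto.const_sub
    apply tendsto_finsetSum
    intro n hn
    have hn0 : (0 : ℝ) < n := by
      rw [hI, Finset.mem_Ioc] at hn
      exact_mod_cast (Nat.zero_le _).trans_lt hn.1
    apply Filter.Tendsto.mul_const
    have : Continuous (fun σ : ℝ => (n : ℝ) ^ (-σ)) :=
      Continuous.rpow continuous_const continuous_neg (fun _ => Or.inl hn0.ne')
    exact this.tendsto 1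
  have fin := le_of_tendsto_of_tendsto lim1 lim2 (by
    filter_upwards [self_mem_nhdsWithin] with σ hσ
    exact key σ hσ)
  have low := lower_bound (u := u) hT1
  linarith

theorem gap_nth {ε : ℝ} (hε : 0 < ε) : ∃ N : ℕ, ∀ n ≥ N,
    (Nat.nth Nat.Prime (n + 1) : ℝ) ≤ (1 + ε) * Nat.nth Nat.Prime n := by
  have hl : 0 < Real.log (1 + ε) := Real.log_pos (by linarith)
  set δ := Real.log (1 + ε) / 2 with hδ
  have h := gap_log (δ := δ) (by positivity)
  obtain ⟨U, hU⟩ := Filter.eventually_atTop.1 h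
  refine ⟨⌈Real.exp U⌉₊, fun n hn => ?_⟩
  have hq := Nat.add_two_le_nth_prime n
  set q := Nat.nth Nat.Prime n with hqd
  have hq0 : (0 : ℝ) < q := by exact_mod_cast (by omega : 0 < q)
  have hUq : U ≤ Real.log q := by
    rw [Real.le_log_iff_exp_le hq0]
    have h1 := Nat.le_ceil (Real.exp U)
    have h2 : ((⌈Real.exp U⌉₊ : ℕ) : ℝ) ≤ q := by exact_mod_cast (by omega : ⌈Real.exp U⌉₊ ≤ q)
    linarith
  obtain ⟨p, hp, h1, h2⟩ := hU (Real.log q + δ) (by linarith)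
  have hp0 : (0 : ℝ) < p := by exact_mod_cast hp.pos
  have hqp : q < p := by
    have : (q : ℝ) < p := (Real.log_lt_log_iff hq0 hp0).1 (by linarith)
    exact_mod_cast this
  have hle : Nat.nth Nat.Prime (n + 1) ≤ p := by
    have hinf := Nat.infinite_setOfPred_prime
    rw [← Nat.nth_count hp]
    apply Nat.nth_monotone hinf
    rw [← Nat.nth_count hp] at hqp
    exact (Nat.nth_lt_nth hinf).1 hqp
  have hpe : (p : ℝ) ≤ (1 + ε) * q := by
    rw [← Real.log_le_log_iff hp0 (by positivity), Real.log_mul (by positivity) hq0.ne']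
    linarith
  have : (Nat.nth Nat.Prime (n + 1) : ℝ) ≤ p := by exact_mod_cast hle
  linarith

theorem gap_iter (K : ℕ) {η : ℝ} (hη : 1 < η) : ∃ N : ℕ, ∀ n ≥ N,
    (Nat.nth Nat.Prime (n + K) : ℝ) ≤ η * Nat.nth Nat.Prime n := by
  obtain ⟨ε, hε, hεη⟩ : ∃ ε : ℝ, 0 < ε ∧ (1 + ε) ^ K ≤ η := by
    have hc : Continuous (fun ε : ℝ => (1 + ε) ^ K) := by fun_prop
    have h := (hc.tendsto 0).mono_left (nhdsWithin_le_nhds (s := Set.Ioi 0))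
    have h2 := h.eventually (gt_mem_nhds (show (1 + (0:ℝ)) ^ K < η by simpa using hη))
    obtain ⟨ε, h3, h4⟩ := (h2.and self_mem_nhdsWithin).exists
    exact ⟨ε, h4, h3.le⟩
  obtain ⟨N, hN⟩ := gap_nth hε
  refine ⟨N, fun n hn => ?_⟩
  have : ∀ k : ℕ, (Nat.nth Nat.Prime (n + k) : ℝ) ≤ (1 + ε) ^ k * Nat.nth Nat.Prime n := by
    intro k
    induction k with
    | zero => simp
    | succ k ih =>
      have := hN (n + k) (by omega)
      calc _ ≤ (1 + ε) * (Nat.nth Nat.Prime (n + k) : ℝ) := this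
        _ ≤ (1 + ε) * ((1 + ε) ^ k * Nat.nth Nat.Prime n) := by gcongr
        _ = _ := by ring
  refine (this K).trans ?_
  gcongr

theorem sum_primes_gt (g h : ℕ) (hg : 1 < g) (hh : 1 ≤ h) (hhg : h < g)
    (c : Fin g → ℕ) (d : Fin h → ℕ) (hd : ∀ j, 0 < d j) :
    ∃ N : ℕ, 0 < N ∧ ∀ n : ℕ, N ≤ n → (∀ i, c i < n) →
      (∑ i, nthPrime (n - c i)) > ∑ j, nthPrime (n + d j) := by
  have hmono := Nat.nth_monotone Nat.infinite_setOfPred_prime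
  set A := ∑ i, c i with hA
  set D := ∑ j, d j with hD
  have hη : (1 : ℝ) < (2 * h + 1) / (2 * h) := by
    have : (0 : ℝ) < h := by exact_mod_cast hh
    rw [one_lt_div (by positivity)]; linarith
  obtain ⟨N, hN⟩ := gap_iter (A + D) hη
  refine ⟨N + A + 1, by omega, fun n hn _ => ?_⟩
  have hK := hN (n - A - 1) (by omega)
  rw [show n - A - 1 + (A + D) = n + D - 1 by omega] at hK
  have h0 : (0 : ℝ) < h := by exact_mod_cast hh
  set P := Nat.nth Nat.Prime (n - A - 1)
  set Q := Nat.nth Nat.Prime (n + D - 1)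
  have hP : 0 < P := (Nat.prime_nth_prime _).pos
  have e1 : g * P ≤ ∑ i, nthPrime (n - c i) := by
    have : ∀ i ∈ Finset.univ, P ≤ nthPrime (n - c i) := by
      intro i hi
      have := Finset.single_le_sum (f := c) (fun _ _ => Nat.zero_le _) hi
      exact hmono (by omega)
    simpa using Finset.card_nsmul_le_sum _ _ _ this
  have e2 : ∑ j, nthPrime (n + d j) ≤ h * Q := by
    have : ∀ j ∈ Finset.univ, nthPrime (n + d j) ≤ Q := by
      intro i hi
      have := Finset.single_le_sum (f := d) (fun _ _ => Nat.zero_le _) hi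
      exact hmono (by omega)
    simpa using Finset.sum_le_card_nsmul _ _ _ this
  have e3 : h * Q < g * P := by
    have hP' : (0 : ℝ) < P := by exact_mod_cast hP
    have hg' : (h : ℝ) + 1 ≤ g := by exact_mod_cast hhg
    have : (h : ℝ) * Q < g * P := by
      calc (h : ℝ) * Q ≤ h * ((2 * h + 1) / (2 * h) * P) := by gcongr
        _ = (h + 1 / 2) * P := by field_simp
        _ < g * P := by gcongr; linarith
    exact_mod_cast this
  omega
end

section
/- Let p_n denote the n-th prime (p_1 = 2, p_2 = 3, ...). Then p_n is asymptotic to n·log n; that is, the ratio p_n / (n·log n) tends to 1 as n → ∞. -/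
open Filter

section
noncomputable def pntKer (v : ℝ) : ℝ := 2 * (1 - Real.cos v) / v ^ 2

noncomputable def pntTent (t : ℝ) : ℝ := max 0 (1 - |t|)

lemma pntKer_nonneg (v : ℝ) : 0 ≤ pntKer v := by
  have := Real.cos_le_one v
  unfold pntKer
  apply div_nonneg <;> nlinarith [sq_nonneg v]

lemma pntKer_measurable : Measurable pntKer := by
  unfold pntKer; fun_prop

lemma pntKer_le (v : ℝ) : pntKer v ≤ 5 * (1 + v ^ 2)⁻¹ := by
  unfold pntKer
  have h1 := Real.one_sub_sq_div_two_le_cos (x := v)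
  have h2 := Real.neg_one_le_cos v
  rcases eq_or_ne v 0 with rfl | hv
  · norm_num
  have : 0 < v ^ 2 := by positivity
  rw [← div_eq_mul_inv, div_le_div_iff₀ this (by positivity)]
  nlinarith

open MeasureTheory Set Topology

lemma pntKer_integrable : Integrable pntKer := by
  refine (integrable_inv_one_add_sq.const_mul 5).mono' pntKer_measurable.aestronglyMeasurable ?_
  filter_upwards with v
  rw [Real.norm_of_nonneg (pntKer_nonneg v)]
  exact pntKer_le v

lemma pntKer_integral_pos : 0 < ∫ v, pntKer v := by
  rw [integral_pos_iff_support_of_nonneg pntKer_nonneg pntKer_integrable]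
  have : Ioo (0:ℝ) 1 ⊆ Function.support pntKer := by
    intro v hv
    simp only [Function.mem_support]
    have h1 : Real.cos v < 1 := by
      rw [← Real.cos_zero]
      exact Real.cos_lt_cos_of_nonneg_of_le_pi le_rfl (by linarith [hv.2, Real.pi_gt_three]) hv.1
    have : 0 < v ^ 2 := by have := hv.1; positivity
    have : 0 < pntKer v := by unfold pntKer; apply div_pos <;> linarith
    exact this.ne'
  refine lt_of_lt_of_le ?_ (measure_mono this)
  simp

lemma pntTent_continuous : Continuous pntTent := by unfold pntTent; fun_prop

lemma pntTent_nonneg (t : ℝ) : 0 ≤ pntTent t := le_max_left _ _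

lemma pntTent_zero {t : ℝ} (h : 1 ≤ |t|) : pntTent t = 0 := by
  unfold pntTent; rw [max_eq_left]; linarith

lemma pntTent_compact : HasCompactSupport pntTent := by
  refine HasCompactSupport.of_support_subset_isCompact (isCompact_Icc (a := (-1:ℝ)) (b := 1)) ?_
  intro t ht
  by_contra h
  apply ht
  apply pntTent_zero
  rw [mem_Icc, ← abs_le] at h
  linarith

lemma pntTent_integrable : Integrable pntTent :=
  pntTent_continuous.integrable_of_hasCompactSupport pntTent_compact

lemma pntTent_ft {v : ℝ} (hv : v ≠ 0) :
    ∫ t, (pntTent t : ℂ) * Complex.exp (Complex.I * t * v) = (pntKer v : ℂ) := by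
  have hsupp : ∫ t, (pntTent t : ℂ) * Complex.exp (Complex.I * t * v)
      = ∫ t in (-1:ℝ)..1, (pntTent t : ℂ) * Complex.exp (Complex.I * t * v) := by
    rw [intervalIntegral.integral_of_le (by norm_num)]
    symm
    apply setIntegral_eq_integral_of_forall_compl_eq_zero
    intro t ht
    rw [pntTent_zero]
    · simp
    · by_contra h
      rw [not_le, abs_lt] at h
      exact ht ⟨h.1, h.2.le⟩
  have hc : Continuous fun t : ℝ => (pntTent t : ℂ) * Complex.exp (Complex.I * t * v) := by
    have := pntTent_continuous
    fun_prop
  rw [hsupp, ← intervalIntegral.integral_add_adjacent_intervals (b := 0)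
    (hc.intervalIntegrable _ _) (hc.intervalIntegrable _ _)]
  have hvc : (v : ℂ) ≠ 0 := by exact_mod_cast hv
  have hder (s : ℂ) (t : ℝ) : HasDerivAt (fun t : ℝ => (1 + s * t) * Complex.exp (Complex.I * t * v) / (Complex.I * v)
      + s * Complex.exp (Complex.I * t * v) / v ^ 2)
      ((1 + s * t) * Complex.exp (Complex.I * t * v)) t := by
    have h1 : HasDerivAt (fun t : ℝ => (t : ℂ)) 1 t := Complex.ofRealCLM.hasDerivAt
    have he : HasDerivAt (fun t : ℝ => Complex.exp (Complex.I * t * v))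
        (Complex.exp (Complex.I * t * v) * (Complex.I * 1 * v)) t :=
      ((h1.const_mul Complex.I).mul_const (v : ℂ)).cexp
    have := ((((h1.const_mul s).const_add 1).mul he).div_const (Complex.I * v)).add
      ((he.const_mul s).div_const ((v:ℂ) ^ 2))
    refine this.congr_deriv ?_
    field_simp
    ring_nf
    simp
  have e1 : ∫ t in (-1:ℝ)..0, (pntTent t : ℂ) * Complex.exp (Complex.I * t * v)
      = ∫ t in (-1:ℝ)..0, (1 + 1 * t) * Complex.exp (Complex.I * t * v) := by
    apply intervalIntegral.integral_congr
    intro t ht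
    rw [uIcc_of_le (by norm_num)] at ht
    have : pntTent t = 1 + t := by
      unfold pntTent; rw [abs_of_nonpos ht.2, max_eq_right] <;> linarith [ht.1]
    simp [this]
  have e2 : ∫ t in (0:ℝ)..1, (pntTent t : ℂ) * Complex.exp (Complex.I * t * v)
      = ∫ t in (0:ℝ)..1, (1 + (-1) * t) * Complex.exp (Complex.I * t * v) := by
    apply intervalIntegral.integral_congr
    intro t ht
    rw [uIcc_of_le (by norm_num)] at ht
    have : pntTent t = 1 - t := by
      unfold pntTent; rw [abs_of_nonneg ht.1, max_eq_right]; linarith [ht.2]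
    simp [this, sub_eq_add_neg]
  rw [e1, e2, intervalIntegral.integral_eq_sub_of_hasDerivAt (fun t _ => hder 1 t),
    intervalIntegral.integral_eq_sub_of_hasDerivAt (fun t _ => hder (-1) t)]
  · have hcos : Complex.exp (v * Complex.I) + Complex.exp (-(v * Complex.I)) = 2 * Complex.cos v := by
      rw [Complex.cos]; ring_nf
    unfold pntKer
    push_cast
    simp only [mul_zero, zero_mul, Complex.exp_zero]
    field_simp
    ring_nf
    linear_combination -Complex.I * hcos
  · exact Continuous.intervalIntegrable (by fun_prop) _ _
  · exact Continuous.intervalIntegrable (by fun_prop) _ _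
end

section
open MeasureTheory Set Topology

lemma pnt_expdecay {H : ℝ → ℝ} (hm : Measurable H) {M : ℝ} (hM : ∀ u, |H u| ≤ M)
    (h0 : ∀ u ≤ 0, H u = 0) {ε : ℝ} (hε : 0 < ε) :
    Integrable (fun u => H u * Real.exp (-ε * u)) := by
  have h1 : Integrable (indicator (Ioi (0:ℝ)) (fun u => M * Real.exp (-ε * u))) := by
    rw [integrable_indicator_iff measurableSet_Ioi]
    exact (exp_neg_integrableOn_Ioi 0 hε).const_mul M
  refine h1.mono' (by fun_prop) ?_
  filter_upwards with u
  rcases le_or_gt u 0 with h | h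
  · simp [h0 u h, h]
  · rw [indicator_of_mem (by exact h), norm_mul, Real.norm_eq_abs, Real.norm_eq_abs, Real.abs_exp]
    gcongr
    exact hM u

lemma pnt_fubini {H : ℝ → ℝ} (hm : Measurable H) {M : ℝ} (hM : ∀ u, |H u| ≤ M)
    (h0 : ∀ u ≤ 0, H u = 0) {G : ℂ → ℂ}
    (hL : ∀ z : ℂ, 0 < z.re → ∫ u : ℝ, (H u : ℂ) * Complex.exp (-z * u) = G z)
    {l : ℝ} (hl : 0 < l) {ε : ℝ} (hε : 0 < ε) (y : ℝ) :
    ∫ v : ℝ, ((H (y + v / l) * Real.exp (-ε * (y + v / l)) * pntKer v : ℝ) : ℂ)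
      = l * ∫ t : ℝ, (pntTent t : ℂ) * Complex.exp (-(Complex.I * t * l * y)) *
        G (ε - Complex.I * t * l) := by
  have hI := pnt_expdecay hm hM h0 hε
  have hI2 : Integrable (fun v => H (y + v / l) * Real.exp (-ε * (y + v / l))) :=
    (hI.comp_add_left y).comp_div hl.ne'
  have hI3 : Integrable (fun p : ℝ × ℝ =>
      Complex.exp (Complex.I * p.2 * p.1) *
      (((H (y + p.1 / l) * Real.exp (-ε * (y + p.1 / l)) : ℝ) : ℂ) * (pntTent p.2 : ℂ)))
      (volume.prod volume) := by
    refine Integrable.bdd_mul (c := 1) (hI2.ofReal.mul_prod pntTent_integrable.ofReal) ?_ ?_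
    · exact Continuous.aestronglyMeasurable (by fun_prop)
    · filter_upwards with p
      have : Complex.I * p.2 * p.1 = ((p.2 * p.1 : ℝ) : ℂ) * Complex.I := by push_cast; ring
      rw [this, Complex.norm_exp_ofReal_mul_I]
  calc _ = ∫ v : ℝ, ∫ t : ℝ, Complex.exp (Complex.I * t * v) *
      (((H (y + v / l) * Real.exp (-ε * (y + v / l)) : ℝ) : ℂ) * (pntTent t : ℂ)) := by
        apply integral_congr_ae
        have : ∀ᵐ v : ℝ, v ≠ 0 := by simp [ae_iff]
        filter_upwards [this] with v hv
        rw [Complex.ofReal_mul, ← pntTent_ft hv, ← integral_const_mul]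
        congr 1; ext t; ring
    _ = ∫ t : ℝ, ∫ v : ℝ, Complex.exp (Complex.I * t * v) *
      (((H (y + v / l) * Real.exp (-ε * (y + v / l)) : ℝ) : ℂ) * (pntTent t : ℂ)) :=
        integral_integral_swap hI3
    _ = _ := by
        rw [← integral_const_mul]
        congr 1; ext t
        have hz : 0 < ((ε : ℂ) - Complex.I * t * l).re := by simpa using hε
        rw [← hL _ hz]
        have key := Measure.integral_comp_div (fun v : ℝ => Complex.exp (Complex.I * t * (l * v)) *
          (((H (y + v) * Real.exp (-ε * (y + v)) : ℝ) : ℂ) * (pntTent t : ℂ))) l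
        have key2 := integral_add_left_eq_self (μ := volume) (fun u : ℝ => Complex.exp (Complex.I * t * (l * (u - y))) *
          (((H u * Real.exp (-ε * u) : ℝ) : ℂ) * (pntTent t : ℂ))) y
        have e1 : ∀ v : ℝ, (l : ℂ) * ((v / l : ℝ) : ℂ) = v := by
          intro v; have : (l:ℂ) ≠ 0 := by exact_mod_cast hl.ne'
          push_cast; field_simp
        simp only [e1] at key
        rw [key, abs_of_pos hl, Complex.real_smul]
        simp only [Complex.ofReal_add, add_sub_cancel_left] at key2
        rw [key2, ← integral_const_mul, ← integral_const_mul, ← integral_const_mul]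
        congr 1; ext u
        have : Complex.exp (-((ε : ℂ) - Complex.I * t * l) * u) =
           Complex.exp (Complex.I * t * l * u) * Complex.exp (-ε * u) := by
          rw [← Complex.exp_add]; ring_nf
        have h2 : Complex.exp (Complex.I * t * (l * (u - y))) =
           Complex.exp (Complex.I * t * l * u) * Complex.exp (-(Complex.I * t * l * y)) := by
          rw [← Complex.exp_add]; ring_nf
        rw [this, h2]
        push_cast
        ring

theorem pnt_wiener {H : ℝ → ℝ} (hm : Measurable H) {M : ℝ} (hM : ∀ u, |H u| ≤ M)
    (h0 : ∀ u ≤ 0, H u = 0) {G : ℂ → ℂ} (hG : ContinuousOn G {z | 0 ≤ z.re})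
    (hL : ∀ z : ℂ, 0 < z.re → ∫ u : ℝ, (H u : ℂ) * Complex.exp (-z * u) = G z)
    {l : ℝ} (hl : 0 < l) :
    Tendsto (fun y => ∫ v : ℝ, H (y + v / l) * pntKer v) atTop (𝓝 0) := by
  have hM0 : 0 ≤ M := (abs_nonneg _).trans (hM 0)
  -- the limiting identity
  have hid (y : ℝ) : ((∫ v : ℝ, H (y + v / l) * pntKer v : ℝ) : ℂ)
      = l * ∫ t : ℝ, (pntTent t : ℂ) * Complex.exp (-(Complex.I * t * l * y)) *
        G (((0:ℝ):ℂ) - Complex.I * t * l) := by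
    have hA : Tendsto (fun ε : ℝ => ∫ v : ℝ, ((H (y + v / l) * Real.exp (-ε * (y + v / l)) * pntKer v : ℝ) : ℂ))
        (𝓝[>] 0) (𝓝 (∫ v : ℝ, ((H (y + v / l) * pntKer v : ℝ) : ℂ))) := by
      refine tendsto_integral_filter_of_dominated_convergence (fun v => M * pntKer v) ?_ ?_
        (pntKer_integrable.const_mul M) ?_
      · filter_upwards with ε
        have := pntKer_measurable
        exact Measurable.aestronglyMeasurable (by fun_prop)
      · filter_upwards [self_mem_nhdsWithin] with ε hε
        filter_upwards with v
        rw [Complex.norm_real, norm_mul, norm_mul, Real.norm_of_nonneg (pntKer_nonneg v)]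
        apply mul_le_mul_of_nonneg_right _ (pntKer_nonneg v)
        rcases le_or_gt (y + v / l) 0 with h | h
        · simp [h0 _ h, hM0]
        · rw [Real.norm_of_nonneg (Real.exp_nonneg _)]
          have h1 : Real.exp (-ε * (y + v / l)) ≤ 1 := by
            rw [Real.exp_le_one_iff]
            have : 0 < ε := hε
            nlinarith
          calc _ ≤ M * 1 := mul_le_mul (hM _) h1 (Real.exp_nonneg _) hM0
            _ = M := mul_one M
      · filter_upwards with v
        have : Continuous fun ε : ℝ => ((H (y + v / l) * Real.exp (-ε * (y + v / l)) * pntKer v : ℝ) : ℂ) := by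
          fun_prop
        have := (this.tendsto 0).mono_left (nhdsWithin_le_nhds (s := Ioi 0))
        simpa using this
    have hcont : ∀ ε : ℝ, 0 ≤ ε → Continuous fun t : ℝ => G (ε - Complex.I * t * l) := by
      intro ε hε
      refine hG.comp_continuous (by fun_prop) ?_
      intro t
      simpa using hε
    obtain ⟨B, hB⟩ : ∃ B, ∀ ε ∈ Icc (0:ℝ) 1, ∀ t ∈ Icc (-1:ℝ) 1, ‖G (ε - Complex.I * t * l)‖ ≤ B := by
      have hc : ContinuousOn (fun p : ℝ × ℝ => G (p.1 - Complex.I * p.2 * l)) (Icc (0:ℝ) 1 ×ˢ Icc (-1:ℝ) 1) := by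
        refine hG.comp (Continuous.continuousOn (by fun_prop)) ?_
        rintro ⟨a, b⟩ ⟨h, -⟩
        simpa using h.1
      obtain ⟨B, hB⟩ := (isCompact_Icc.prod isCompact_Icc).exists_bound_of_continuousOn hc
      exact ⟨B, fun ε hε t ht => hB (ε, t) ⟨hε, ht⟩⟩
    have hexp : ∀ t : ℝ, ‖Complex.exp (-(Complex.I * t * l * y))‖ = 1 := by
      intro t
      have : -(Complex.I * t * l * y) = ((-(t * l * y) : ℝ) : ℂ) * Complex.I := by push_cast; ring
      rw [this, Complex.norm_exp_ofReal_mul_I]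
    have hB' : Tendsto (fun ε : ℝ => ∫ t : ℝ, (pntTent t : ℂ) * Complex.exp (-(Complex.I * t * l * y)) *
        G (ε - Complex.I * t * l)) (𝓝[>] 0)
        (𝓝 (∫ t : ℝ, (pntTent t : ℂ) * Complex.exp (-(Complex.I * t * l * y)) *
        G (((0:ℝ):ℂ) - Complex.I * t * l))) := by
      refine tendsto_integral_filter_of_dominated_convergence (fun t => B * pntTent t) ?_ ?_
        (pntTent_integrable.const_mul B) ?_
      · filter_upwards [self_mem_nhdsWithin] with ε hε
        have := pntTent_continuous
        have := hcont ε (le_of_lt hε)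
        exact Continuous.aestronglyMeasurable (Continuous.mul (by fun_prop) this)
      · filter_upwards [Ioo_mem_nhdsGT (zero_lt_one)] with ε hε
        filter_upwards with t
        rw [norm_mul, norm_mul, hexp, mul_one, Complex.norm_real, Real.norm_of_nonneg (pntTent_nonneg t), mul_comm]
        by_cases ht : 1 ≤ |t|
        · simp [pntTent_zero ht]
        · apply mul_le_mul_of_nonneg_right _ (pntTent_nonneg t)
          exact hB ε ⟨hε.1.le, hε.2.le⟩ t (abs_le.mp (not_le.mp ht).le)
      · filter_upwards with t
        apply Tendsto.const_mul
        have h1 : Tendsto G (𝓝[{z | 0 ≤ z.re}] (((0:ℝ):ℂ) - Complex.I * t * l)) (𝓝 (G (((0:ℝ):ℂ) - Complex.I * t * l))) :=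
          hG _ (by simp)
        refine h1.comp ?_
        refine tendsto_nhdsWithin_iff.mpr ⟨?_, ?_⟩
        · have : Continuous fun ε : ℝ => (ε : ℂ) - Complex.I * t * l := by fun_prop
          exact (this.tendsto 0).mono_left nhdsWithin_le_nhds
        · filter_upwards [self_mem_nhdsWithin] with ε hε
          simpa using le_of_lt hε
    rw [← integral_complex_ofReal]
    refine tendsto_nhds_unique hA ((hB'.const_mul (l:ℂ)).congr' ?_)
    filter_upwards [self_mem_nhdsWithin] with ε hε
    exact (pnt_fubini hm hM h0 hL hl hε y).symm
  have hRL := Real.tendsto_integral_exp_smul_cocompact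
    (fun t : ℝ => (pntTent t : ℂ) * G (((0:ℝ):ℂ) - Complex.I * t * l))
  have hlin : Tendsto (fun y : ℝ => (l / (2 * Real.pi)) * y) atTop (cocompact ℝ) := by
    refine Tendsto.mono_right ?_ atTop_le_cocompact
    exact tendsto_id.const_mul_atTop (by positivity)
  have h2 := (hRL.comp hlin).const_mul (l : ℂ)
  have h3 : Tendsto (fun y => ((∫ v : ℝ, H (y + v / l) * pntKer v : ℝ) : ℂ)) atTop (𝓝 ((0:ℝ):ℂ)) := by
    rw [mul_zero] at h2
    refine h2.congr ?_
    intro y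
    rw [hid y]
    simp only [Function.comp]
    congr 2
    ext t
    rw [Circle.smul_def, Real.fourierChar_apply, smul_eq_mul]
    have : ((2 * Real.pi * -(t * (l / (2 * Real.pi) * y)) : ℝ) : ℂ) * Complex.I = -(Complex.I * t * l * y) := by
      have : (Real.pi : ℂ) ≠ 0 := by exact_mod_cast Real.pi_ne_zero
      push_cast; field_simp
    rw [this]; ring
  exact_mod_cast (Complex.continuous_re.tendsto _).comp h3
end

section
open MeasureTheory Set Topology

lemma pnt_tail {η : ℝ} (hη : 0 < η) :
    ∃ R : ℝ, 0 < R ∧ ∫ v, indicator {v | R < |v|} pntKer v ≤ η := by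
  have h : Tendsto (fun n : ℕ => ∫ v, indicator {v | (n:ℝ) < |v|} pntKer v) atTop (𝓝 (∫ _v : ℝ, (0:ℝ))) := by
    refine tendsto_integral_of_dominated_convergence pntKer ?_ pntKer_integrable ?_ ?_
    · intro n
      exact (pntKer_measurable.indicator (measurableSet_lt measurable_const (by fun_prop))).aestronglyMeasurable
    · intro n
      filter_upwards with v
      refine (norm_indicator_le_norm_self _ _).trans ?_
      rw [Real.norm_of_nonneg (pntKer_nonneg v)]
    · filter_upwards with v
      apply tendsto_const_nhds.congr'
      obtain ⟨N, hN⟩ := exists_nat_ge |v|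
      filter_upwards [eventually_ge_atTop N] with n hn
      rw [indicator_of_notMem]
      simp only [mem_ofPred_eq, not_lt]
      exact hN.trans (by exact_mod_cast hn)
  simp only [integral_zero] at h
  obtain ⟨n, hn, hn'⟩ := ((h.eventually (gt_mem_nhds hη)).and (eventually_gt_atTop 0)).exists
  exact ⟨n, by exact_mod_cast hn', hn.le⟩

theorem pnt_tauber {H : ℝ → ℝ} (hm : Measurable H) {M : ℝ} (hM : ∀ u, |H u| ≤ M)
    (h1 : ∀ u, -1 ≤ H u)
    (hmono : ∀ u > 0, ∀ h ≥ 0, H u + 1 ≤ Real.exp h * (H (u + h) + 1))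
    (hW : ∀ l : ℝ, 0 < l → Tendsto (fun y => ∫ v : ℝ, H (y + v / l) * pntKer v) atTop (𝓝 0)) :
    Tendsto H atTop (𝓝 0) := by
  have hM0 : 0 ≤ M := (abs_nonneg _).trans (hM 0)
  rw [Metric.tendsto_nhds]
  intro δ hδ
  set I := ∫ v, pntKer v with hI
  have hIpos : 0 < I := pntKer_integral_pos
  obtain ⟨η, hη, hη1, hηδ⟩ : ∃ η : ℝ, 0 < η ∧ η ≤ 1 ∧ 4 * η ≤ δ :=
    ⟨min 1 (δ / 4), by positivity, min_le_left _ _, by linarith [min_le_right 1 (δ/4)]⟩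
  set D := 2 * M + 1 with hD
  have hDpos : 0 < D := by positivity
  obtain ⟨R, hR, htail⟩ := pnt_tail (η := η * I / (2 * D)) (by positivity)
  set T := ∫ v, indicator {v | R < |v|} pntKer v with hT
  have hTi : Integrable (indicator {v | R < |v|} pntKer) :=
    pntKer_integrable.indicator (measurableSet_lt measurable_const (by fun_prop))
  set h := Real.log (1 + η) with hh
  have hhpos : 0 < h := Real.log_pos (by linarith)
  have hexp : Real.exp h = 1 + η := Real.exp_log (by linarith)
  set l := 2 * R / h with hl
  have hlpos : 0 < l := by positivity
  have hDT : D * T ≤ η * I / 2 := by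
    calc D * T ≤ D * (η * I / (2 * D)) := by gcongr
      _ = η * I / 2 := by field_simp
  have hHi (y : ℝ) : Integrable fun v => H (y + v / l) * pntKer v := by
    refine pntKer_integrable.bdd_mul (c := M) ?_ ?_
    · exact Measurable.aestronglyMeasurable (by fun_prop)
    · filter_upwards with v; exact hM _
  have hrange (v : ℝ) (hv : |v| ≤ R) : -(h/2) ≤ v / l ∧ v / l ≤ h / 2 := by
    rw [← abs_le, abs_div, abs_of_pos hlpos, div_le_iff₀ hlpos, hl]
    calc |v| ≤ R := hv
      _ = h / 2 * (2 * R / h) := by field_simp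
  have hlow (y c : ℝ) (hc : c ≤ M) (hcH : ∀ v, |v| ≤ R → c ≤ H (y + v / l)) :
      c * I - D * T ≤ ∫ v, H (y + v / l) * pntKer v := by
    rw [hI, hT, ← integral_const_mul, ← integral_const_mul, ← integral_sub (pntKer_integrable.const_mul _) (hTi.const_mul _)]
    refine integral_mono ((pntKer_integrable.const_mul _).sub (hTi.const_mul _)) (hHi y) ?_
    intro v
    have hk := pntKer_nonneg v
    simp only
    by_cases hv : R < |v|
    · rw [indicator_of_mem (by exact hv), ← sub_mul]
      gcongr
      linarith [(abs_le.mp (hM (y + v / l))).1]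
    · rw [indicator_of_notMem (by exact hv), mul_zero, sub_zero]
      gcongr
      exact hcH v (not_lt.mp hv)
  have hupp (y c : ℝ) (hc : -1 ≤ c) (hcH : ∀ v, |v| ≤ R → H (y + v / l) ≤ c) :
      ∫ v, H (y + v / l) * pntKer v ≤ c * I + D * T := by
    rw [hI, hT, ← integral_const_mul, ← integral_const_mul, ← integral_add (pntKer_integrable.const_mul _) (hTi.const_mul _)]
    refine integral_mono (hHi y) ((pntKer_integrable.const_mul _).add (hTi.const_mul _)) ?_
    intro v
    have hk := pntKer_nonneg v
    simp only
    by_cases hv : R < |v|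
    · rw [indicator_of_mem (by exact hv), ← add_mul]
      gcongr
      linarith [(abs_le.mp (hM (y + v / l))).2]
    · rw [indicator_of_notMem (by exact hv), mul_zero, add_zero]
      gcongr
      exact hcH v (not_lt.mp hv)
  have hF : ∀ᶠ y in atTop, |∫ v : ℝ, H (y + v / l) * pntKer v| < η * I / 2 := by
    have := (Metric.tendsto_nhds.mp (hW l hlpos)) (η * I / 2) (by positivity)
    simpa [Real.dist_eq] using this
  have hF1 := (tendsto_atTop_add_const_right atTop (h/2) tendsto_id).eventually hF
  have hF2 := (tendsto_atTop_add_const_right atTop (-(h/2)) tendsto_id).eventually hF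
  filter_upwards [hF1, hF2, eventually_gt_atTop h] with y hy1 hy2 hyh
  simp only [id] at hy1 hy2
  set a := H y with ha
  have haM := abs_le.mp (hM y)
  have ha1 := h1 y
  rw [Real.dist_eq, sub_zero, abs_lt]
  constructor
  · have := hupp (y + -(h/2)) ((1 + η) * (a + 1) - 1) (by nlinarith) ?_
    · have h3 := (abs_lt.mp hy2).1
      have h4 : -η < (1 + η) * (a + 1) - 1 := by
        by_contra hcon
        nlinarith
      nlinarith
    · intro v hv
      obtain ⟨hv1, hv2⟩ := hrange v hv
      have h5 := hmono (y + -(h/2) + v / l) (by linarith) (h/2 - v/l) (by linarith)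
      rw [show y + -(h/2) + v / l + (h/2 - v/l) = y by ring] at h5
      have h6 : Real.exp (h/2 - v/l) ≤ 1 + η := by
        rw [← hexp]; apply Real.exp_le_exp.mpr; linarith
      have h7 : Real.exp (h/2 - v/l) * (H y + 1) ≤ (1 + η) * (H y + 1) :=
        mul_le_mul_of_nonneg_right h6 (by linarith)
      linarith
  · have := hlow (y + h/2) ((a + 1) / (1 + η) - 1) ?_ ?_
    · have h3 := (abs_lt.mp hy1).2
      have h4 : (a + 1) / (1 + η) - 1 < η := by
        by_contra hcon
        nlinarith
      have h5 : a + 1 < (1 + η) * (1 + η) := by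
        rw [← div_lt_iff₀ (by linarith)]; linarith
      nlinarith
    · have : (a + 1) / (1 + η) ≤ a + 1 := div_le_self (by linarith) (by linarith)
      linarith
    · intro v hv
      obtain ⟨hv1, hv2⟩ := hrange v hv
      have h5 := hmono y (by linarith) (h/2 + v/l) (by linarith)
      rw [show y + (h/2 + v/l) = y + h/2 + v / l by ring] at h5
      have h6 : Real.exp (h/2 + v/l) ≤ 1 + η := by
        rw [← hexp]; apply Real.exp_le_exp.mpr; linarith
      have h7 : Real.exp (h/2 + v/l) * (H (y + h/2 + v / l) + 1) ≤ (1 + η) * (H (y + h/2 + v / l) + 1) :=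
        mul_le_mul_of_nonneg_right h6 (by linarith [h1 (y + h/2 + v / l)])
      have h8 : (a + 1) / (1 + η) ≤ H (y + h/2 + v / l) + 1 := by
        rw [div_le_iff₀ (by linarith)]; linarith
      linarith

noncomputable def pntH (u : ℝ) : ℝ := if 0 < u then Chebyshev.psi (Real.exp u) * Real.exp (-u) - 1 else 0

lemma pntH_measurable : Measurable pntH := by
  unfold pntH
  have := Chebyshev.psi_mono.measurable
  refine Measurable.ite (measurableSet_lt measurable_const measurable_id) (by fun_prop) (by fun_prop)

lemma pntH_neg_one_le (u : ℝ) : -1 ≤ pntH u := by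
  unfold pntH
  split_ifs
  · have := mul_nonneg (Chebyshev.psi_nonneg (Real.exp u)) (Real.exp_nonneg (-u))
    linarith
  · norm_num

lemma pntH_bound (u : ℝ) : |pntH u| ≤ Real.log 4 + 4 := by
  have h4 : 0 ≤ Real.log 4 := Real.log_nonneg (by norm_num)
  rw [abs_le]
  refine ⟨by linarith [pntH_neg_one_le u], ?_⟩
  unfold pntH
  split_ifs
  · have := Chebyshev.psi_le_const_mul_self (Real.exp_nonneg u)
    have : Chebyshev.psi (Real.exp u) * Real.exp (-u) ≤ (Real.log 4 + 4) * Real.exp u * Real.exp (-u) := by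
      gcongr
    rw [mul_assoc, ← Real.exp_add] at this
    simp at this
    linarith
  · linarith

lemma pntH_mono : ∀ u > 0, ∀ h ≥ 0, pntH u + 1 ≤ Real.exp h * (pntH (u + h) + 1) := by
  intro u hu h hh
  have : 0 < u + h := by linarith
  simp only [pntH, hu, this, if_true, sub_add_cancel]
  have e : Real.exp h * (Chebyshev.psi (Real.exp (u + h)) * Real.exp (-(u + h))) =
      Chebyshev.psi (Real.exp (u + h)) * Real.exp (-u) := by
    rw [show -u = h + -(u + h) by ring, Real.exp_add h]; ring
  rw [e]
  have : Chebyshev.psi (Real.exp u) ≤ Chebyshev.psi (Real.exp (u + h)) := by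
    apply Chebyshev.psi_mono
    apply Real.exp_le_exp.mpr; linarith
  exact mul_le_mul_of_nonneg_right this (Real.exp_nonneg _)

noncomputable def pntG (z : ℂ) : ℂ :=
  (ArithmeticFunction.vonMangoldt.LFunctionResidueClassAux (q := 1) 1 (1 + z) - 1) / (1 + z)

lemma pntG_cont : ContinuousOn pntG {z | 0 ≤ z.re} := by
  unfold pntG
  refine ContinuousOn.div (ContinuousOn.sub ?_ continuousOn_const) (by fun_prop) ?_
  · refine (ArithmeticFunction.vonMangoldt.continuousOn_LFunctionResidueClassAux (q := 1) 1).comp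
      (Continuous.continuousOn (by fun_prop)) ?_
    intro z hz
    simpa using hz
  · intro z hz h
    have := congrArg Complex.re h
    simp at this hz
    linarith

lemma pnt_LSeries {s : ℂ} (hs : 1 < s.re) :
    ArithmeticFunction.vonMangoldt.LFunctionResidueClassAux (q := 1) 1 s =
      LSeries (fun n => (ArithmeticFunction.vonMangoldt n : ℂ)) s - 1 / (s - 1) := by
  have := ArithmeticFunction.vonMangoldt.eqOn_LFunctionResidueClassAux (q := 1) (a := 1) isUnit_one hs
  rw [this]
  simp only [Nat.totient_one, Nat.cast_one, inv_one]
  congr 2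
  ext n
  rw [ArithmeticFunction.vonMangoldt.residueClass, indicator_of_mem]
  exact Subsingleton.elim _ _

lemma pnt_LSeries_int {s : ℂ} (hs : 1 < s.re) :
    LSeries (fun n => (ArithmeticFunction.vonMangoldt n : ℂ)) s =
      s * ∫ t in Ioi (1:ℝ), (Chebyshev.psi t : ℂ) * (t : ℂ) ^ (-(s + 1)) := by
  rw [LSeries_eq_mul_integral_of_nonneg (fun n => ArithmeticFunction.vonMangoldt n) zero_le_one hs ?_
    (fun n => ArithmeticFunction.vonMangoldt_nonneg)]
  · congr 2
    ext t
    rw [Chebyshev.psi]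
    push_cast
    rfl
  · refine Asymptotics.IsBigO.of_bound (Real.log 4 + 4) ?_
    filter_upwards with n
    have h := Chebyshev.psi_le_const_mul_self (Nat.cast_nonneg (α := ℝ) n)
    have h0 := Chebyshev.psi_nonneg n
    have e : ∑ k ∈ Finset.Icc 1 n, ArithmeticFunction.vonMangoldt k = Chebyshev.psi n := by
      rw [Chebyshev.psi, Nat.floor_natCast]; rfl
    rw [e, Real.norm_of_nonneg h0, Real.rpow_one, Real.norm_of_nonneg (Nat.cast_nonneg n)]
    exact h

lemma pnt_laplace (z : ℂ) (hz : 0 < z.re) :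
    ∫ u : ℝ, (pntH u : ℂ) * Complex.exp (-z * u) = pntG z := by
  have hs : 1 < (1 + z).re := by simpa using hz
  have h0 : ∀ u ≤ 0, pntH u = 0 := fun u hu => by simp [pntH, not_lt.mpr hu]
  have hHi : Integrable fun u : ℝ => (pntH u : ℂ) * Complex.exp (-z * u) := by
    refine (pnt_expdecay pntH_measurable pntH_bound h0 hz).mono ?_ ?_
    · have := pntH_measurable
      exact Measurable.aestronglyMeasurable (by fun_prop)
    · filter_upwards with u
      simp [Complex.norm_exp]
  have hEi : IntegrableOn (fun u : ℝ => Complex.exp (-z * u)) (Ioi 0) :=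
    integrableOn_exp_mul_complex_Ioi (by simpa using hz) 0
  have hE : ∫ u in Ioi (0:ℝ), Complex.exp (-z * u) = 1 / z := by
    rw [integral_exp_mul_complex_Ioi (by simpa using hz) 0]
    simp
  have hset : ∫ u : ℝ, (pntH u : ℂ) * Complex.exp (-z * u) =
      ∫ u in Ioi (0:ℝ), (pntH u : ℂ) * Complex.exp (-z * u) := by
    symm
    apply setIntegral_eq_integral_of_forall_compl_eq_zero
    intro u hu
    rw [h0 u (not_lt.mp hu)]; simp
  have hpsi : ∫ t in Ioi (1:ℝ), (Chebyshev.psi t : ℂ) * (t : ℂ) ^ (-((1 + z) + 1)) =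
      ∫ u in Ioi (0:ℝ), ((pntH u : ℂ) * Complex.exp (-z * u) + Complex.exp (-z * u)) := by
    rw [← Real.exp_zero, ← integral_comp_exp_Ioi]
    refine setIntegral_congr_fun measurableSet_Ioi ?_
    intro u hu
    have hu' : (0:ℝ) < u := hu
    simp only [pntH, hu', if_true]
    rw [Complex.cpow_def_of_ne_zero (by exact_mod_cast (Real.exp_pos u).ne'), ← Complex.ofReal_log (Real.exp_nonneg u),
      Real.log_exp, Complex.real_smul]
    push_cast
    rw [show (u:ℂ) * (-(1 + z + 1)) = -u + -u + -z * u by ring, Complex.exp_add, Complex.exp_add, Complex.exp_neg]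
    have := Complex.exp_ne_zero u
    field_simp
    ring
  have hz0 : z ≠ 0 := by rintro rfl; simp at hz
  have hz1 : 1 + z ≠ 0 := by
    intro h; rw [h] at hs; simp at hs; linarith
  rw [pntG, pnt_LSeries hs, pnt_LSeries_int hs, hpsi, integral_add hHi.integrableOn hEi, hE, ← hset, add_sub_cancel_left]
  generalize ∫ u : ℝ, (pntH u : ℂ) * Complex.exp (-z * u) = J
  field_simp
  ring

theorem pnt_psi : Tendsto (fun x : ℝ => Chebyshev.psi x / x) atTop (𝓝 1) := by
  have h0 : ∀ u ≤ 0, pntH u = 0 := fun u hu => by simp [pntH, not_lt.mpr hu]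
  have h := pnt_tauber pntH_measurable pntH_bound pntH_neg_one_le pntH_mono
    (fun l hl => pnt_wiener pntH_measurable pntH_bound h0 pntG_cont pnt_laplace hl)
  have h2 := (h.comp Real.tendsto_log_atTop).add_const 1
  rw [zero_add] at h2
  refine h2.congr' ?_
  filter_upwards [eventually_gt_atTop 1] with x hx
  have : 0 < x := by linarith
  simp [pntH, Real.log_pos hx, Real.exp_neg, Real.exp_log this, div_eq_mul_inv]

theorem pnt_pi : Tendsto (fun x : ℝ => (Nat.primeCounting ⌊x⌋₊ : ℝ) * Real.log x / x) atTop (𝓝 1) := by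
  have hth : Tendsto (fun x : ℝ => Chebyshev.theta x / x) atTop (𝓝 1) := by
    have hsq : Tendsto (fun x : ℝ => (Chebyshev.psi x - Chebyshev.theta x) / x) atTop (𝓝 0) := by
      have h1 : (fun x : ℝ => √x) =o[atTop] (fun x : ℝ => x) := by
        refine Asymptotics.isLittleO_iff_tendsto' ?_ |>.mpr ?_
        · filter_upwards [eventually_gt_atTop 0] with x hx h
          exact absurd h hx.ne'
        · refine Tendsto.congr (f₁ := fun x ↦ (√x)⁻¹) ?_ Real.tendsto_sqrt_atTop.inv_tendsto_atTop
          intro x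
          rw [Real.sqrt_div_self', one_div]
      exact (Chebyshev.isBigO_psi_sub_theta_sqrt.trans_isLittleO h1).tendsto_div_nhds_zero
    have := pnt_psi.sub hsq
    rw [sub_zero] at this
    refine this.congr fun x => ?_
    ring
  have h2 : Tendsto (fun x : ℝ => ((Nat.primeCounting ⌊x⌋₊ : ℝ) - Chebyshev.theta x / Real.log x) / (x / Real.log x)) atTop (𝓝 0) := by
    have h1 : (fun x : ℝ => x / Real.log x ^ 2) =o[atTop] (fun x : ℝ => x / Real.log x) := by
      refine Asymptotics.isLittleO_iff_tendsto' (by simp) |>.mpr ?_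
      refine Tendsto.congr' (f₁ := fun x ↦ (Real.log x)⁻¹) ?_ Real.tendsto_log_atTop.inv_tendsto_atTop
      filter_upwards [eventually_gt_atTop 0] with x _
      field
    exact (Chebyshev.primeCounting_sub_theta_div_log_isBigO.trans_isLittleO h1).tendsto_div_nhds_zero
  have := h2.add hth
  rw [zero_add] at this
  refine this.congr' ?_
  filter_upwards [eventually_gt_atTop 1] with x hx
  have := Real.log_pos hx
  field_simp
  ring

end

theorem nthPrime_asymptotic :
    Tendsto (fun n : ℕ => (nthPrime n : ℝ) / ((n : ℝ) * Real.log n))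
      atTop (nhds 1) := by
  have hp : Tendsto (fun n : ℕ => (nthPrime n : ℝ)) atTop atTop := by
    refine tendsto_natCast_atTop_atTop.comp ?_
    exact (Nat.nth_strictMono Nat.infinite_setOf_prime).tendsto_atTop.comp (tendsto_sub_atTop_nat 1)
  have hr : Tendsto (fun n : ℕ => (n : ℝ) * Real.log (nthPrime n) / nthPrime n) atTop (nhds 1) := by
    refine (pnt_pi.comp hp).congr' ?_
    filter_upwards [eventually_ge_atTop 1] with n hn
    simp only [Function.comp, Nat.floor_natCast]
    have : Nat.primeCounting (nthPrime n) = n := by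
      rw [nthPrime, Nat.primeCounting, Nat.primeCounting', Nat.count_nth_succ_of_infinite Nat.infinite_setOf_prime]
      omega
    rw [this]
  have hlp : Tendsto (fun n : ℕ => Real.log (nthPrime n)) atTop atTop := Real.tendsto_log_atTop.comp hp
  have hll : Tendsto (fun n : ℕ => Real.log (Real.log (nthPrime n)) / Real.log (nthPrime n)) atTop (nhds 0) :=
    (Real.isLittleO_log_id_atTop.tendsto_div_nhds_zero).comp hlp
  have hlr : Tendsto (fun n : ℕ => Real.log ((n : ℝ) * Real.log (nthPrime n) / nthPrime n) / Real.log (nthPrime n)) atTop (nhds 0) := by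
    have := hr.log one_ne_zero
    rw [Real.log_one] at this
    exact this.div_atTop hlp
  have hq : Tendsto (fun n : ℕ => Real.log n / Real.log (nthPrime n)) atTop (nhds 1) := by
    have := (hlr.sub hll).const_add 1
    simp only [sub_zero, add_zero] at this
    refine this.congr' ?_
    filter_upwards [eventually_ge_atTop 1, hp.eventually_gt_atTop 1] with n hn hpn
    have h1 := Real.log_pos hpn
    have h2 : (n:ℝ) ≠ 0 := by positivity
    rw [Real.log_div (by positivity) (by positivity), Real.log_mul h2 h1.ne']
    field_simp
    ring
  have := (hr.mul hq).inv₀ (by norm_num)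
  simp only [mul_one, inv_one] at this
  refine this.congr' ?_
  filter_upwards [eventually_ge_atTop 2, hp.eventually_gt_atTop 1] with n hn hpn
  have h1 := Real.log_pos hpn
  have h2 : (1:ℝ) < n := by exact_mod_cast hn
  have h3 := Real.log_pos h2
  field_simp
end

section
/- Let p_n denote the n-th prime (p_1 = 2, p_2 = 3, ...). For every integer n ≥ 2, 9·p_{n+1} < 16·p_{n-1} + 56. -/
lemma aux_small (p : ℕ) (h2 : 2 ≤ p) (hp : p < 115987) :
    ∃ a b : ℕ, a.Prime ∧ b.Prime ∧ p < a ∧ a < b ∧ 9 * b < 16 * p + 56 := by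
  rcases lt_or_ge p 3 with h | h
  · exact ⟨3, 5, by norm_num, by norm_num, by omega, by omega, by omega⟩
  clear h2; rename' h => h2
  rcases lt_or_ge p 5 with h | h
  · exact ⟨5, 7, by norm_num, by norm_num, by omega, by omega, by omega⟩
  clear h2; rename' h => h2
  rcases lt_or_ge p 7 with h | h
  · exact ⟨7, 11, by norm_num, by norm_num, by omega, by omega, by omega⟩
  clear h2; rename' h => h2
  rcases lt_or_ge p 11 with h | h
  · exact ⟨11, 13, by norm_num, by norm_num, by omega, by omega, by omega⟩
  clear h2; rename' h => h2
  rcases lt_or_ge p 13 with h | h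
  · exact ⟨13, 19, by norm_num, by norm_num, by omega, by omega, by omega⟩
  clear h2; rename' h => h2
  rcases lt_or_ge p 19 with h | h
  · exact ⟨19, 23, by norm_num, by norm_num, by omega, by omega, by omega⟩
  clear h2; rename' h => h2
  rcases lt_or_ge p 23 with h | h
  · exact ⟨23, 31, by norm_num, by norm_num, by omega, by omega, by omega⟩
  clear h2; rename' h => h2
  rcases lt_or_ge p 31 with h | h
  · exact ⟨31, 41, by norm_num, by norm_num, by omega, by omega, by omega⟩
  clear h2; rename' h => h2
  rcases lt_or_ge p 41 with h | h
  · exact ⟨41, 53, by norm_num, by norm_num, by omega, by omega, by omega⟩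
  clear h2; rename' h => h2
  rcases lt_or_ge p 53 with h | h
  · exact ⟨53, 71, by norm_num, by norm_num, by omega, by omega, by omega⟩
  clear h2; rename' h => h2
  rcases lt_or_ge p 71 with h | h
  · exact ⟨71, 89, by norm_num, by norm_num, by omega, by omega, by omega⟩
  clear h2; rename' h => h2
  rcases lt_or_ge p 89 with h | h
  · exact ⟨89, 113, by norm_num, by norm_num, by omega, by omega, by omega⟩
  clear h2; rename' h => h2
  rcases lt_or_ge p 113 with h | h
  · exact ⟨113, 151, by norm_num, by norm_num, by omega, by omega, by omega⟩
  clear h2; rename' h => h2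
  rcases lt_or_ge p 151 with h | h
  · exact ⟨151, 199, by norm_num, by norm_num, by omega, by omega, by omega⟩
  clear h2; rename' h => h2
  rcases lt_or_ge p 199 with h | h
  · exact ⟨199, 263, by norm_num, by norm_num, by omega, by omega, by omega⟩
  clear h2; rename' h => h2
  rcases lt_or_ge p 263 with h | h
  · exact ⟨263, 349, by norm_num, by norm_num, by omega, by omega, by omega⟩
  clear h2; rename' h => h2
  rcases lt_or_ge p 349 with h | h
  · exact ⟨349, 461, by norm_num, by norm_num, by omega, by omega, by omega⟩
  clear h2; rename' h => h2
  rcases lt_or_ge p 461 with h | h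
  · exact ⟨461, 607, by norm_num, by norm_num, by omega, by omega, by omega⟩
  clear h2; rename' h => h2
  rcases lt_or_ge p 607 with h | h
  · exact ⟨607, 797, by norm_num, by norm_num, by omega, by omega, by omega⟩
  clear h2; rename' h => h2
  rcases lt_or_ge p 797 with h | h
  · exact ⟨797, 1051, by norm_num, by norm_num, by omega, by omega, by omega⟩
  clear h2; rename' h => h2
  rcases lt_or_ge p 1051 with h | h
  · exact ⟨1051, 1381, by norm_num, by norm_num, by omega, by omega, by omega⟩
  clear h2; rename' h => h2
  rcases lt_or_ge p 1381 with h | h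
  · exact ⟨1381, 1823, by norm_num, by norm_num, by omega, by omega, by omega⟩
  clear h2; rename' h => h2
  rcases lt_or_ge p 1823 with h | h
  · exact ⟨1823, 2399, by norm_num, by norm_num, by omega, by omega, by omega⟩
  clear h2; rename' h => h2
  rcases lt_or_ge p 2399 with h | h
  · exact ⟨2399, 3167, by norm_num, by norm_num, by omega, by omega, by omega⟩
  clear h2; rename' h => h2
  rcases lt_or_ge p 3167 with h | h
  · exact ⟨3167, 4177, by norm_num, by norm_num, by omega, by omega, by omega⟩
  clear h2; rename' h => h2
  rcases lt_or_ge p 4177 with h | h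
  · exact ⟨4177, 5507, by norm_num, by norm_num, by omega, by omega, by omega⟩
  clear h2; rename' h => h2
  rcases lt_or_ge p 5507 with h | h
  · exact ⟨5507, 7253, by norm_num, by norm_num, by omega, by omega, by omega⟩
  clear h2; rename' h => h2
  rcases lt_or_ge p 7253 with h | h
  · exact ⟨7253, 9551, by norm_num, by norm_num, by omega, by omega, by omega⟩
  clear h2; rename' h => h2
  rcases lt_or_ge p 9551 with h | h
  · exact ⟨9551, 12601, by norm_num, by norm_num, by omega, by omega, by omega⟩
  clear h2; rename' h => h2
  rcases lt_or_ge p 12601 with h | h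
  · exact ⟨12601, 16633, by norm_num, by norm_num, by omega, by omega, by omega⟩
  clear h2; rename' h => h2
  rcases lt_or_ge p 16633 with h | h
  · exact ⟨16633, 21943, by norm_num, by norm_num, by omega, by omega, by omega⟩
  clear h2; rename' h => h2
  rcases lt_or_ge p 21943 with h | h
  · exact ⟨21943, 28961, by norm_num, by norm_num, by omega, by omega, by omega⟩
  clear h2; rename' h => h2
  rcases lt_or_ge p 28961 with h | h
  · exact ⟨28961, 38219, by norm_num, by norm_num, by omega, by omega, by omega⟩
  clear h2; rename' h => h2
  rcases lt_or_ge p 38219 with h | h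
  · exact ⟨38219, 50441, by norm_num, by norm_num, by omega, by omega, by omega⟩
  clear h2; rename' h => h2
  rcases lt_or_ge p 50441 with h | h
  · exact ⟨50441, 66571, by norm_num, by norm_num, by omega, by omega, by omega⟩
  clear h2; rename' h => h2
  rcases lt_or_ge p 66571 with h | h
  · exact ⟨66571, 87869, by norm_num, by norm_num, by omega, by omega, by omega⟩
  clear h2; rename' h => h2
  rcases lt_or_ge p 87869 with h | h
  · exact ⟨87869, 115987, by norm_num, by norm_num, by omega, by omega, by omega⟩
  clear h2; rename' h => h2
  rcases lt_or_ge p 115987 with h | h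
  · exact ⟨115987, 153089, by norm_num, by norm_num, by omega, by omega, by omega⟩
  clear h2; rename' h => h2
  omega

lemma aux_dvd (n : ℕ) : (30 * n).factorial * n.factorial ∣
    Nat.lcmUpto (30 * n) * ((15 * n).factorial * (10 * n).factorial * (6 * n).factorial) := by
  have f0 := fun m : ℕ => Nat.factorial_ne_zero m
  have l0 := Nat.lcmUpto_ne_zero (30 * n)
  rw [← Nat.factorization_prime_le_iff_dvd (mul_ne_zero (f0 _) (f0 _))
    (mul_ne_zero l0 (mul_ne_zero (mul_ne_zero (f0 _) (f0 _)) (f0 _)))]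
  intro p hp
  rw [Nat.factorization_mul (f0 _) (f0 _),
    Nat.factorization_mul l0 (mul_ne_zero (mul_ne_zero (f0 _) (f0 _)) (f0 _)),
    Nat.factorization_mul (mul_ne_zero (f0 _) (f0 _)) (f0 _),
    Nat.factorization_mul (f0 _) (f0 _)]
  simp only [Finsupp.add_apply]
  have hb : ∀ m, m ≤ 30 * n → Nat.log p m < Nat.log p (30 * n) + 1 := fun m hm =>
    Nat.lt_succ_of_le (Nat.log_mono_right hm)
  rw [Nat.factorization_lcmUpto _ hp, Nat.factorization_factorial hp (hb (30 * n) le_rfl),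
    Nat.factorization_factorial hp (hb n (by omega)),
    Nat.factorization_factorial hp (hb (15 * n) (by omega)),
    Nat.factorization_factorial hp (hb (10 * n) (by omega)),
    Nat.factorization_factorial hp (hb (6 * n) (by omega))]
  have h1 : Nat.log p (30 * n) = ∑ i ∈ Finset.Ico 1 (Nat.log p (30 * n) + 1), 1 := by simp
  generalize Nat.log p (30 * n) = L at h1 ⊢
  conv_rhs => lhs; rw [h1]
  simp only [← Finset.sum_add_distrib]
  apply Finset.sum_le_sum
  intro i _
  generalize p ^ i = q
  have e1 : n / q = 30 * n / q / 30 := by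
    rw [Nat.div_div_eq_div_mul, mul_comm q, ← Nat.div_div_eq_div_mul]; congr 1; omega
  have e2 : 15 * n / q = 30 * n / q / 2 := by
    rw [Nat.div_div_eq_div_mul, mul_comm q, ← Nat.div_div_eq_div_mul]; congr 1; omega
  have e3 : 10 * n / q = 30 * n / q / 3 := by
    rw [Nat.div_div_eq_div_mul, mul_comm q, ← Nat.div_div_eq_div_mul]; congr 1; omega
  have e4 : 6 * n / q = 30 * n / q / 5 := by
    rw [Nat.div_div_eq_div_mul, mul_comm q, ← Nat.div_div_eq_div_mul]; congr 1; omega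
  rw [e1, e2, e3, e4]
  omega

lemma aux_fact (n : ℕ) (hn : 1 ≤ n) :
    n * Real.log n - n ≤ Real.log n.factorial ∧
    Real.log n.factorial ≤ n * Real.log n - n + Real.log n + 1 := by
  induction n, hn using Nat.le_induction with
  | base => simp
  | succ n hn ih =>
    have hn0 : (0 : ℝ) < n := by exact_mod_cast hn
    have hn1 : (0 : ℝ) < (n : ℝ) + 1 := by linarith
    have hf : (n.factorial : ℝ) ≠ 0 := by exact_mod_cast Nat.factorial_ne_zero n
    rw [Nat.factorial_succ]
    push_cast
    rw [Real.log_mul hn1.ne' hf]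
    have a1 := Real.log_le_sub_one_of_pos (div_pos hn1 hn0)
    have a2 := Real.log_le_sub_one_of_pos (div_pos hn0 hn1)
    rw [Real.log_div hn1.ne' hn0.ne'] at a1
    rw [Real.log_div hn0.ne' hn1.ne'] at a2
    have b1 := mul_le_mul_of_nonneg_left a1 hn0.le
    have b2 := mul_le_mul_of_nonneg_left a2 hn1.le
    have c1 : (n : ℝ) * (((n : ℝ) + 1) / n - 1) = 1 := by field_simp; ring
    have c2 : ((n : ℝ) + 1) * ((n : ℝ) / (n + 1) - 1) = -1 := by field_simp; ring
    rw [c1] at b1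
    rw [c2] at b2
    constructor <;> nlinarith [ih.1, ih.2]

lemma aux_const : 34 * Real.log 2 + 4 ≤ 14 * Real.log 2 + 9 * Real.log 3 + 5 * Real.log 5 := by
  have h : (4 : ℝ) ≤ Real.log (3 ^ 9 * 5 ^ 5 / 2 ^ 20) := by
    rw [Real.le_log_iff_exp_le (by norm_num)]
    have : Real.exp 4 = Real.exp 1 ^ 4 := by rw [← Real.exp_nat_mul]; norm_num
    rw [this]
    calc Real.exp 1 ^ 4 ≤ (2.7182818286 : ℝ) ^ 4 :=
          pow_le_pow_left₀ (Real.exp_pos 1).le Real.exp_one_lt_d9.le 4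
      _ ≤ _ := by norm_num
  rw [Real.log_div (by norm_num) (by norm_num), Real.log_mul (by norm_num) (by norm_num),
    Real.log_pow, Real.log_pow, Real.log_pow] at h
  push_cast at h
  linarith

lemma aux_psi (n : ℕ) (hn : 1 ≤ n) :
    n * (34 * Real.log 2 + 4) - 3 * Real.log (30 * n) - 3 ≤ Chebyshev.psi ((30 * n : ℕ) : ℝ) := by
  rw [Chebyshev.psi_eq_log_lcmUpto]
  have f0 : ∀ m : ℕ, (m.factorial : ℝ) ≠ 0 := fun m => by exact_mod_cast Nat.factorial_ne_zero m
  have l0 : (Nat.lcmUpto (30 * n) : ℝ) ≠ 0 := by exact_mod_cast Nat.lcmUpto_ne_zero _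
  have h := Nat.le_of_dvd (Nat.mul_pos (Nat.lcmUpto_pos _) (by positivity)) (aux_dvd n)
  have h' : ((30 * n).factorial : ℝ) * n.factorial ≤
    Nat.lcmUpto (30 * n) * ((15 * n).factorial * (10 * n).factorial * (6 * n).factorial) := by
    exact_mod_cast h
  have h2 := Real.log_le_log (by positivity) h'
  rw [Real.log_mul (f0 _) (f0 _),
    Real.log_mul l0 (mul_ne_zero (mul_ne_zero (f0 _) (f0 _)) (f0 _)),
    Real.log_mul (mul_ne_zero (f0 _) (f0 _)) (f0 _), Real.log_mul (f0 _) (f0 _)] at h2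
  have t1 := (aux_fact (30 * n) (by omega)).1
  have t2 := (aux_fact n hn).1
  have t3 := (aux_fact (15 * n) (by omega)).2
  have t4 := (aux_fact (10 * n) (by omega)).2
  have t5 := (aux_fact (6 * n) (by omega)).2
  have hn0 : (0 : ℝ) < n := by exact_mod_cast hn
  push_cast at t1 t2 t3 t4 t5
  have L2 : 0 ≤ Real.log 2 := Real.log_nonneg (by norm_num)
  have L3 : 0 ≤ Real.log 3 := Real.log_nonneg (by norm_num)
  have L5 : 0 ≤ Real.log 5 := Real.log_nonneg (by norm_num)
  have e30 : Real.log (30 * n) = Real.log 2 + Real.log 3 + Real.log 5 + Real.log n := by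
    rw [← Real.log_mul (by norm_num) (by norm_num), ← Real.log_mul (by norm_num) (by norm_num),
      ← Real.log_mul (by norm_num) hn0.ne']; norm_num
  have e15 : Real.log (15 * n) = Real.log 3 + Real.log 5 + Real.log n := by
    rw [← Real.log_mul (by norm_num) (by norm_num),
      ← Real.log_mul (by norm_num) hn0.ne']; norm_num
  have e10 : Real.log (10 * n) = Real.log 2 + Real.log 5 + Real.log n := by
    rw [← Real.log_mul (by norm_num) (by norm_num),
      ← Real.log_mul (by norm_num) hn0.ne']; norm_num
  have e6 : Real.log (6 * n) = Real.log 2 + Real.log 3 + Real.log n := by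
    rw [← Real.log_mul (by norm_num) (by norm_num),
      ← Real.log_mul (by norm_num) hn0.ne']; norm_num
  rw [e30] at t1 ⊢
  rw [e15] at t3
  rw [e10] at t4
  rw [e6] at t5
  have hc := mul_le_mul_of_nonneg_left aux_const hn0.le
  linarith

lemma aux_theta (p q N : ℕ) (hq : q.Prime) (h : ∀ r : ℕ, r.Prime → r < N → r ≤ p ∨ r = q)
    (M : ℕ) (hM : M < N) : Chebyshev.theta (M : ℝ) ≤ Real.log 4 * p + Real.log q := by
  have h1 : Chebyshev.theta (M : ℝ) ≤ Chebyshev.theta (p : ℝ) + Real.log q := by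
    rw [Chebyshev.theta_eq_sum_primesLE_log, Chebyshev.theta_eq_sum_primesLE_log]
    have hnn : ∀ r : ℕ, 0 ≤ Real.log r := fun r => Real.log_natCast_nonneg r
    calc ∑ r ∈ Nat.primesLE M, Real.log r
        ≤ ∑ r ∈ insert q (Nat.primesLE p), Real.log r := by
          apply Finset.sum_le_sum_of_subset_of_nonneg
          · intro r hr
            rw [Nat.mem_primesLE] at hr
            rw [Finset.mem_insert, Nat.mem_primesLE]
            rcases h r hr.2 (by omega) with h' | h'
            · exact Or.inr ⟨h', hr.2⟩
            · exact Or.inl h'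
          · intro r _ _; exact hnn r
      _ ≤ _ := by
          by_cases hm : q ∈ Nat.primesLE p
          · rw [Finset.insert_eq_of_mem hm]; linarith [hnn q]
          · rw [Finset.sum_insert hm]; linarith
  linarith [Chebyshev.theta_le_log4_mul_x (x := (p : ℝ)) (by positivity)]

lemma aux_large (p q N : ℕ) (hp : 115987 ≤ p) (hpq : p < q) (hqN : q < N) (hq : q.Prime)
    (h : ∀ r : ℕ, r.Prime → r < N → r ≤ p ∨ r = q) : 9 * N < 16 * p + 56 := by
  by_contra hcon
  push Not at hcon
  obtain ⟨k, hk1, hk2⟩ : ∃ k, 30 * k < N ∧ N ≤ 30 * k + 30 :=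
    ⟨(N - 1) / 30, by omega, by omega⟩
  have hk : 3866 ≤ k := by omega
  have t := aux_theta p q N hq h (30 * k) hk1
  have hkR : (3866 : ℝ) ≤ k := by exact_mod_cast hk
  have t2 := Chebyshev.psi_sub_theta_le (x := ((30 * k : ℕ) : ℝ)) (by push_cast; linarith)
  have t3 := aux_psi k (by omega)
  push_cast at t t2 t3
  set s := √(30 * (k : ℝ)) with hs
  have hss : s * s = 30 * k := Real.mul_self_sqrt (by positivity)
  have hs340 : 340 ≤ s := by
    apply Real.le_sqrt_of_sq_le; linarith
  have hlog : Real.log (30 * k) = 2 * Real.log s := by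
    rw [← hss, Real.log_mul (by positivity) (by positivity)]; ring
  have hq2 : Real.log q ≤ Real.log 2 + 2 * Real.log s := by
    rw [← hlog, ← Real.log_mul (by norm_num) (by positivity)]
    apply Real.log_le_log
    · exact_mod_cast hq.pos
    · have : q ≤ 2 * (30 * k) := by omega
      exact_mod_cast this
  have hl4 : Real.log 4 = 2 * Real.log 2 := by
    rw [show (4 : ℝ) = 2 ^ 2 by norm_num, Real.log_pow]; norm_num
  have hpk : (16 : ℝ) * p ≤ 270 * k + 214 := by
    have : 16 * p ≤ 270 * k + 214 := by omega
    exact_mod_cast this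
  have L2 := Real.log_two_lt_d9
  have L2' : 0 ≤ Real.log 2 := Real.log_nonneg (by norm_num)
  have hls : Real.log s ≤ s / 256 + 4.5452 := by
    have := Real.log_le_sub_one_of_pos (x := s / 256) (by positivity)
    rw [Real.log_div (by positivity) (by norm_num), show (256 : ℝ) = 2 ^ 8 by norm_num,
      Real.log_pow] at this
    norm_num at this ⊢
    linarith
  rw [hl4] at t
  rw [hlog] at t2 t3
  have m1 := mul_le_mul_of_nonneg_left hpk L2'
  have m2 : s * Real.log s ≤ s * (s / 256 + 4.5452) :=
    mul_le_mul_of_nonneg_left hls (by positivity)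
  have m3 : 0 ≤ (k : ℝ) * Real.log 2 := by positivity
  nlinarith

theorem nine_mul_next_prime_lt (n : ℕ) (hn : 2 ≤ n) :
    9 * nthPrime (n + 1) < 16 * nthPrime (n - 1) + 56 := by
  obtain ⟨m, rfl⟩ : ∃ m, n = m + 2 := ⟨n - 2, by omega⟩
  unfold nthPrime
  rw [show m + 2 + 1 - 1 = m + 1 + 1 by omega, show m + 2 - 1 - 1 = m by omega]
  have hP := Nat.prime_nth_prime m
  have hm := Nat.nth_strictMono Nat.infinite_setOf_prime
  have h1 := hm (Nat.lt_succ_self m)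
  have h2 := hm (Nat.lt_succ_self (m + 1))
  rcases lt_or_ge (Nat.nth Nat.Prime m) 115987 with h | h
  · obtain ⟨a, b, ha, hb, hpa, hab, hh⟩ := aux_small _ hP.two_le h
    have ha' : Nat.nth Nat.Prime (m + 1) ≤ a := by
      by_contra hc
      have := Nat.le_nth_of_lt_nth_succ (not_le.mp hc) ha
      omega
    have hb' : Nat.nth Nat.Prime (m + 1 + 1) ≤ b := by
      by_contra hc
      have := Nat.le_nth_of_lt_nth_succ (not_le.mp hc) hb
      omega
    omega
  · refine aux_large _ _ _ h h1 h2 (Nat.prime_nth_prime (m + 1)) ?_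
    intro r hr hrN
    rcases (Nat.le_nth_of_lt_nth_succ hrN hr).lt_or_eq with h' | h'
    · exact Or.inl (Nat.le_nth_of_lt_nth_succ h' hr)
    · exact Or.inr h'
end

section
/- For every integer m ≥ 1, there is a prime number in the open interval (m, 4(m+2)/3). -/
open Finset in
theorem loo_logfac (n k : ℕ) (hk : 0 < k) :
    Real.log ((n / k).factorial : ℝ)
      = ∑ d ∈ Ioc 0 n, ArithmeticFunction.vonMangoldt d * ((n / d / k : ℕ) : ℝ) := by
  have h1 : Real.log ((n / k).factorial : ℝ)
      = ∑ d ∈ Ioc 0 (n / k), ArithmeticFunction.vonMangoldt d * ((n / k / d : ℕ) : ℝ) := by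
    rw [← ArithmeticFunction.sum_Ioc_mul_zeta_eq_sum, ArithmeticFunction.vonMangoldt_mul_zeta]
    generalize n / k = N
    induction N with
    | zero => simp
    | succ N ih =>
      rw [Nat.factorial_succ, Nat.cast_mul, Real.log_mul (by positivity) (by positivity), ih,
        ← Finset.insert_Ioc_right_eq_Ioc_add_one (Nat.zero_le N), Finset.sum_insert (by simp)]
      simp [ArithmeticFunction.log_apply]
  rw [h1]
  have h2 : ∀ d, n / d / k = n / k / d := fun d => Nat.div_right_comm n d k
  simp_rw [h2]
  apply Finset.sum_subset
  · intro d hd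
    simp only [mem_Ioc] at hd ⊢
    exact ⟨hd.1, hd.2.trans (Nat.div_le_self n k)⟩
  · intro d hd hd'
    simp only [mem_Ioc] at hd hd'
    have : n / k / d = 0 := Nat.div_eq_of_lt (by omega)
    rw [this]; simp

noncomputable def looL (n : ℕ) : ℝ :=
  Real.log ((n / 1).factorial : ℝ) - Real.log ((n / 2).factorial : ℝ)
    - Real.log ((n / 3).factorial : ℝ) - Real.log ((n / 5).factorial : ℝ)
    + Real.log ((n / 30).factorial : ℝ)

open Finset in
theorem looL_eq (n : ℕ) : looL n = ∑ d ∈ Ioc 0 n, ArithmeticFunction.vonMangoldt d *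
    (((n / d / 1 : ℕ) : ℝ) - ((n / d / 2 : ℕ) : ℝ) - ((n / d / 3 : ℕ) : ℝ)
      - ((n / d / 5 : ℕ) : ℝ) + ((n / d / 30 : ℕ) : ℝ)) := by
  unfold looL
  rw [loo_logfac n 1 (by norm_num), loo_logfac n 2 (by norm_num), loo_logfac n 3 (by norm_num),
    loo_logfac n 5 (by norm_num), loo_logfac n 30 (by norm_num)]
  simp only [← Finset.sum_sub_distrib, ← Finset.sum_add_distrib]
  apply Finset.sum_congr rfl
  intro d _
  ring

theorem loo_psi (n : ℕ) : Chebyshev.psi n = ∑ d ∈ Finset.Ioc 0 n, ArithmeticFunction.vonMangoldt d := by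
  simp [Chebyshev.psi]

theorem looL_le_psi (n : ℕ) : looL n ≤ Chebyshev.psi n := by
  rw [looL_eq, loo_psi]
  apply Finset.sum_le_sum
  intro d _
  have h : (((n / d / 1 : ℕ) : ℝ) - ((n / d / 2 : ℕ) : ℝ) - ((n / d / 3 : ℕ) : ℝ)
      - ((n / d / 5 : ℕ) : ℝ) + ((n / d / 30 : ℕ) : ℝ)) ≤ 1 := by
    generalize n / d = k
    have : k / 1 + k / 30 ≤ 1 + k / 2 + k / 3 + k / 5 := by omega
    have : ((k / 1 : ℕ) : ℝ) + ((k / 30 : ℕ) : ℝ)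
      ≤ 1 + ((k / 2 : ℕ) : ℝ) + ((k / 3 : ℕ) : ℝ) + ((k / 5 : ℕ) : ℝ) := by exact_mod_cast this
    linarith
  exact mul_le_of_le_one_right ArithmeticFunction.vonMangoldt_nonneg h

theorem psi_le_looL (n : ℕ) : Chebyshev.psi n ≤ Chebyshev.psi ((n / 6 : ℕ) : ℝ) + looL n := by
  rw [looL_eq, loo_psi, loo_psi]
  have h1 : ∑ d ∈ Finset.Ioc 0 (n / 6), ArithmeticFunction.vonMangoldt d
      = ∑ d ∈ Finset.Ioc 0 n, if d ≤ n / 6 then ArithmeticFunction.vonMangoldt d else 0 := by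
    rw [← Finset.sum_filter]
    apply Finset.sum_congr _ (fun _ _ => rfl)
    ext d
    simp only [Finset.mem_Ioc, Finset.mem_filter]
    omega
  rw [h1, ← Finset.sum_add_distrib]
  apply Finset.sum_le_sum
  intro d hd
  simp only [Finset.mem_Ioc] at hd
  have hL : (0:ℝ) ≤ ArithmeticFunction.vonMangoldt d := ArithmeticFunction.vonMangoldt_nonneg
  have hk1 : 1 ≤ n / d := (Nat.one_le_div_iff hd.1).2 hd.2
  split_ifs with h
  · have h : 0 ≤ (((n / d / 1 : ℕ) : ℝ) - ((n / d / 2 : ℕ) : ℝ) - ((n / d / 3 : ℕ) : ℝ)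
        - ((n / d / 5 : ℕ) : ℝ) + ((n / d / 30 : ℕ) : ℝ)) := by
      generalize n / d = k
      have : k / 2 + k / 3 + k / 5 ≤ k / 1 + k / 30 := by omega
      have : ((k / 2 : ℕ) : ℝ) + ((k / 3 : ℕ) : ℝ) + ((k / 5 : ℕ) : ℝ)
        ≤ ((k / 1 : ℕ) : ℝ) + ((k / 30 : ℕ) : ℝ) := by exact_mod_cast this
      linarith
    nlinarith [mul_nonneg hL h]
  · have hk : n / d < 6 := by
      rw [Nat.div_lt_iff_lt_mul hd.1]
      omega
    have h : 1 ≤ (((n / d / 1 : ℕ) : ℝ) - ((n / d / 2 : ℕ) : ℝ) - ((n / d / 3 : ℕ) : ℝ)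
        - ((n / d / 5 : ℕ) : ℝ) + ((n / d / 30 : ℕ) : ℝ)) := by
      generalize n / d = k at *
      have : 1 + k / 2 + k / 3 + k / 5 ≤ k / 1 + k / 30 := by omega
      have : 1 + ((k / 2 : ℕ) : ℝ) + ((k / 3 : ℕ) : ℝ) + ((k / 5 : ℕ) : ℝ)
        ≤ ((k / 1 : ℕ) : ℝ) + ((k / 30 : ℕ) : ℝ) := by exact_mod_cast this
      linarith
    nlinarith [mul_le_mul_of_nonneg_left h hL]

/-- `a (log b - log a) ≤ b - a`. -/
theorem loo_log_diff {a b : ℝ} (ha : 0 < a) (hb : 0 < b) :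
    a * (Real.log b - Real.log a) ≤ b - a := by
  rw [← Real.log_div hb.ne' ha.ne']
  have h := Real.log_le_sub_one_of_pos (div_pos hb ha)
  have h2 := mul_le_mul_of_nonneg_left h ha.le
  have h3 : a * (b / a - 1) = b - a := by field_simp
  linarith

theorem loo_stirling (n : ℕ) (hn : 1 ≤ n) :
    n * Real.log n - n + 1 ≤ Real.log (n.factorial : ℝ) ∧
    Real.log (n.factorial : ℝ) ≤ n * Real.log n - n + 1 + Real.log n := by
  induction n, hn using Nat.le_induction with
  | base => simp
  | succ n hn ih =>
    have hn' : (0:ℝ) < n := by exact_mod_cast hn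
    rw [Nat.factorial_succ, Nat.cast_mul, Real.log_mul (by positivity) (by positivity)]
    push_cast
    have h1 := loo_log_diff hn' (by linarith : (0:ℝ) < n + 1)
    have h2 := loo_log_diff (by linarith : (0:ℝ) < n + 1) hn'
    constructor <;> nlinarith [ih.1, ih.2]

theorem loo_T (n k : ℕ) (hk : 0 < k) (hkn : k ≤ n) (x : ℝ) (hx : x = (n : ℝ) / k) :
    x * Real.log x - x + 1 - Real.log x ≤ Real.log ((n / k).factorial : ℝ) ∧
    Real.log ((n / k).factorial : ℝ) ≤ x * Real.log x - x + 1 + Real.log x := by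
  have hN : 1 ≤ n / k := (Nat.one_le_div_iff hk).2 hkn
  have hNx : ((n / k : ℕ) : ℝ) ≤ x := by rw [hx]; exact Nat.cast_div_le
  have hk' : (0:ℝ) < k := by exact_mod_cast hk
  have hxN : x < ((n / k : ℕ) : ℝ) + 1 := by
    rw [hx, div_lt_iff₀ hk']
    exact_mod_cast (Nat.div_lt_iff_lt_mul hk).1 (Nat.lt_succ_self (n / k))
  obtain ⟨s1, s2⟩ := loo_stirling _ hN
  generalize n / k = N at *
  have hN' : (1:ℝ) ≤ N := by exact_mod_cast hN
  have hx0 : 0 < x := by linarith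
  have h1 := loo_log_diff (by linarith : (0:ℝ) < N) hx0
  have h2 := loo_log_diff hx0 (by linarith : (0:ℝ) < N)
  have hl : Real.log N ≤ Real.log x := Real.log_le_log (by linarith) hNx
  have hl0 : 0 ≤ Real.log N := Real.log_nonneg hN'
  constructor
  · nlinarith [mul_nonneg (by linarith : 0 ≤ N + 1 - x) (hl0.trans hl)]
  · nlinarith [mul_nonneg (by linarith : 0 ≤ x - N) hl0]

theorem looL_bounds (n : ℕ) (hn : 30 ≤ n) :
    0.92 * (n : ℝ) - 5 * Real.log n ≤ looL n ∧ looL n ≤ 0.922 * (n : ℝ) + 5 * Real.log n := by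
  have hn' : (30:ℝ) ≤ n := by exact_mod_cast hn
  obtain ⟨a1, b1⟩ := loo_T n 1 (by norm_num) (by omega) _ rfl
  obtain ⟨a2, b2⟩ := loo_T n 2 (by norm_num) (by omega) _ rfl
  obtain ⟨a3, b3⟩ := loo_T n 3 (by norm_num) (by omega) _ rfl
  obtain ⟨a5, b5⟩ := loo_T n 5 (by norm_num) (by omega) _ rfl
  obtain ⟨a30, b30⟩ := loo_T n 30 (by norm_num) (by omega) _ rfl
  have hne : (n : ℝ) ≠ 0 := by linarith
  have l30 : Real.log 30 = Real.log 2 + Real.log 3 + Real.log 5 := by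
    rw [← Real.log_mul (by norm_num) (by norm_num), ← Real.log_mul (by norm_num) (by norm_num)]
    norm_num
  push_cast at *
  rw [Real.log_div hne (by norm_num)] at a1 a2 a3 a5 a30 b1 b2 b3 b5 b30
  rw [l30] at a30 b30
  rw [Real.log_one] at a1 b1
  have p1 := Real.log_two_gt_d9
  have p2 := Real.log_two_lt_d9
  have p3 := Real.log_three_gt_d9
  have p4 := Real.log_three_lt_d9
  have p5 := Real.log_five_gt_d9
  have p6 := Real.log_five_lt_d9
  have hA1 : 0.92 ≤ 7/15 * Real.log 2 + 3/10 * Real.log 3 + 1/6 * Real.log 5 := by linarith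
  have hA2 : 7/15 * Real.log 2 + 3/10 * Real.log 3 + 1/6 * Real.log 5 ≤ 0.922 := by linarith
  have hB1 := mul_le_mul_of_nonneg_left hA1 (by linarith : (0:ℝ) ≤ n)
  have hB2 := mul_le_mul_of_nonneg_left hA2 (by linarith : (0:ℝ) ≤ n)
  unfold looL
  constructor
  · ring_nf at *
    linarith
  · ring_nf at *
    linarith

theorem loo_log_le (x : ℝ) (hx : 0 < x) (k : ℕ) : Real.log x ≤ x / 2 ^ k - 1 + k * 0.6932 := by
  have h := Real.log_le_sub_one_of_pos (div_pos hx (by positivity : (0:ℝ) < 2 ^ k))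
  rw [Real.log_div hx.ne' (by positivity), Real.log_pow] at h
  have := Real.log_two_lt_d9
  have := mul_le_mul_of_nonneg_left (by linarith : Real.log 2 ≤ 0.6932) (Nat.cast_nonneg (α := ℝ) k)
  linarith

theorem loo_psi_le (n : ℕ) : Chebyshev.psi n ≤ 1.15 * (n : ℝ) + 10700 := by
  induction n using Nat.strong_induction_on with
  | _ n ih =>
    have hn0 : (0:ℝ) ≤ n := Nat.cast_nonneg n
    by_cases hn : n < 2500
    · have h := Chebyshev.psi_le_const_mul_self hn0
      have l4 : Real.log 4 = 2 * Real.log 2 := by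
        rw [show (4:ℝ) = 2 ^ 2 by norm_num, Real.log_pow]; norm_num
      have := Real.log_two_lt_d9
      have hn' : (n : ℝ) < 2500 := by exact_mod_cast hn
      have := mul_le_mul_of_nonneg_right (by linarith : Real.log 4 + 4 ≤ 5.4) hn0
      linarith
    · have hn' : (2500:ℝ) ≤ n := by exact_mod_cast not_lt.1 hn
      have h1 := psi_le_looL n
      have h2 := (looL_bounds n (by omega)).2
      have h3 := ih (n / 6) (by omega)
      have h4 : ((n / 6 : ℕ) : ℝ) ≤ (n : ℝ) / 6 := by exact_mod_cast Nat.cast_div_le (α := ℝ) (m := n) (n := 6)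
      have h5 := loo_log_le n (by linarith) 11
      norm_num at h5
      linarith

theorem loo_large (m : ℕ) (hm : 1000000 ≤ m) :
    ∃ q : ℕ, q.Prime ∧ m < q ∧ 3 * q < 4 * (m + 2) := by
  by_contra hcon
  push Not at hcon
  obtain ⟨M, hM⟩ : ∃ M, M = 4 * m / 3 := ⟨_, rfl⟩
  have hm' : (1000000:ℝ) ≤ m := by exact_mod_cast hm
  have hM1 : 4 * (m:ℝ) ≤ 3 * M + 2 := by
    have : 4 * m ≤ 3 * M + 2 := by omega
    exact_mod_cast this
  have hM2 : 3 * (M:ℝ) ≤ 4 * m := by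
    have : 3 * M ≤ 4 * m := by omega
    exact_mod_cast this
  have hth : Chebyshev.theta M = Chebyshev.theta m := by
    simp only [Chebyshev.theta, Nat.floor_natCast]
    apply Finset.sum_congr _ (fun _ _ => rfl)
    ext q
    simp only [Finset.mem_filter, Finset.mem_Ioc]
    constructor
    · rintro ⟨⟨h1, h2⟩, h3⟩
      refine ⟨⟨h1, ?_⟩, h3⟩
      by_contra h4
      have := hcon q h3 (by omega)
      omega
    · rintro ⟨⟨h1, h2⟩, h3⟩
      exact ⟨⟨h1, by omega⟩, h3⟩
  have h1 := Chebyshev.psi_sub_theta_le (x := M) (by linarith)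
  have h2 := Chebyshev.theta_le_psi m
  have h3 := loo_psi_le m
  have h4 := looL_le_psi M
  have h5 := (looL_bounds M (by omega)).1
  obtain ⟨s, hs⟩ : ∃ s, s = √(M:ℝ) := ⟨_, rfl⟩
  have hs0 : 0 ≤ s := hs ▸ Real.sqrt_nonneg _
  have hss : s * s = M := by rw [hs]; exact Real.mul_self_sqrt (by linarith)
  have hs1 : 1000 ≤ s := by nlinarith
  have hl : Real.log M = 2 * Real.log s := by
    rw [← hss, Real.log_mul (by linarith) (by linarith)]; ring
  rw [← hs] at h1
  rw [hl] at h1 h5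
  have h6 := loo_log_le s (by linarith) 10
  norm_num at h6
  have h7 := mul_le_mul_of_nonneg_left h6 hs0
  nlinarith

theorem loo_step {n : ℕ} (q : ℕ) {p : ℕ} (prime_p : Nat.Prime p)
    (covering : 3 * p < 4 * (q + 2))
    (H : n < q → ∃ p : ℕ, p.Prime ∧ n < p ∧ 3 * p < 4 * (n + 2)) (hn : n < p) :
    ∃ p : ℕ, p.Prime ∧ n < p ∧ 3 * p < 4 * (n + 2) := by
  by_cases h : n < q
  · exact H h
  · exact ⟨p, prime_p, hn, by omega⟩

theorem loo_small (n : ℕ) (hn : 1 ≤ n) (h : n < 1302397) :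
    ∃ p : ℕ, p.Prime ∧ n < p ∧ 3 * p < 4 * (n + 2) := by
  revert h
  refine loo_step 976823 (by norm_num1) (by norm_num1) ?_
  refine loo_step 732631 (by norm_num1) (by norm_num1) ?_
  refine loo_step 549481 (by norm_num1) (by norm_num1) ?_
  refine loo_step 412123 (by norm_num1) (by norm_num1) ?_
  refine loo_step 309091 (by norm_num1) (by norm_num1) ?_
  refine loo_step 231823 (by norm_num1) (by norm_num1) ?_
  refine loo_step 173867 (by norm_num1) (by norm_num1) ?_
  refine loo_step 130411 (by norm_num1) (by norm_num1) ?_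
  refine loo_step 97813 (by norm_num1) (by norm_num1) ?_
  refine loo_step 73363 (by norm_num1) (by norm_num1) ?_
  refine loo_step 55021 (by norm_num1) (by norm_num1) ?_
  refine loo_step 41281 (by norm_num1) (by norm_num1) ?_
  refine loo_step 30971 (by norm_num1) (by norm_num1) ?_
  refine loo_step 23227 (by norm_num1) (by norm_num1) ?_
  refine loo_step 17419 (by norm_num1) (by norm_num1) ?_
  refine loo_step 13063 (by norm_num1) (by norm_num1) ?_
  refine loo_step 9817 (by norm_num1) (by norm_num1) ?_
  refine loo_step 7369 (by norm_num1) (by norm_num1) ?_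
  refine loo_step 5531 (by norm_num1) (by norm_num1) ?_
  refine loo_step 4159 (by norm_num1) (by norm_num1) ?_
  refine loo_step 3121 (by norm_num1) (by norm_num1) ?_
  refine loo_step 2347 (by norm_num1) (by norm_num1) ?_
  refine loo_step 1759 (by norm_num1) (by norm_num1) ?_
  refine loo_step 1327 (by norm_num1) (by norm_num1) ?_
  refine loo_step 997 (by norm_num1) (by norm_num1) ?_
  refine loo_step 751 (by norm_num1) (by norm_num1) ?_
  refine loo_step 563 (by norm_num1) (by norm_num1) ?_
  refine loo_step 421 (by norm_num1) (by norm_num1) ?_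
  refine loo_step 317 (by norm_num1) (by norm_num1) ?_
  refine loo_step 241 (by norm_num1) (by norm_num1) ?_
  refine loo_step 181 (by norm_num1) (by norm_num1) ?_
  refine loo_step 139 (by norm_num1) (by norm_num1) ?_
  refine loo_step 107 (by norm_num1) (by norm_num1) ?_
  refine loo_step 79 (by norm_num1) (by norm_num1) ?_
  refine loo_step 59 (by norm_num1) (by norm_num1) ?_
  refine loo_step 43 (by norm_num1) (by norm_num1) ?_
  refine loo_step 31 (by norm_num1) (by norm_num1) ?_
  refine loo_step 23 (by norm_num1) (by norm_num1) ?_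
  refine loo_step 17 (by norm_num1) (by norm_num1) ?_
  refine loo_step 11 (by norm_num1) (by norm_num1) ?_
  refine loo_step 7 (by norm_num1) (by norm_num1) ?_
  refine loo_step 5 (by norm_num1) (by norm_num1) ?_
  refine loo_step 2 (by norm_num1) (by norm_num1) ?_
  exact fun h2 => ⟨2, Nat.prime_two, h2, by omega⟩

theorem prime_in_open_interval (m : ℕ) (hm : 1 ≤ m) :
    ∃ q : ℕ, q.Prime ∧ (m : ℝ) < (q : ℝ) ∧ (q : ℝ) < 4 * ((m : ℝ) + 2) / 3 := by
  have key : ∃ p : ℕ, p.Prime ∧ m < p ∧ 3 * p < 4 * (m + 2) := by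
    by_cases h : 1000000 ≤ m
    · exact loo_large m h
    · exact loo_small m hm (by omega)
  obtain ⟨q, h1, h2, h3⟩ := key
  refine ⟨q, h1, by exact_mod_cast h2, ?_⟩
  have : 3 * (q:ℝ) < 4 * ((m:ℝ) + 2) := by exact_mod_cast h3
  linarith
end

section
/- Let p_n denote the n-th prime (p_1 = 2, p_2 = 3, ...). For every integer n ≥ 10, p_{n-2} + p_{n-1} + p_n > p_{n+1} + p_{n+2}, and this fails for n = 9 (i.e., p_7 + p_8 + p_9 < p_{10} + p_{11}). Hence 10 is the least positive integer N such that the inequality holds for all n ≥ N. -/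
open ArithmeticFunction in
lemma aux_sum (M n : ℕ) (h : n ≤ M) :
    ∑ d ∈ Finset.Ioc 0 M, vonMangoldt d * ((n / d : ℕ) : ℝ) = Real.log (n.factorial) := by
  induction n with
  | zero => simp
  | succ n ih =>
    have ih := ih (by omega)
    rw [Nat.factorial_succ, Nat.cast_mul, Real.log_mul (by positivity) (by positivity), ← ih,
      ← vonMangoldt_sum]
    have h1 : ∑ i ∈ (n + 1).divisors, vonMangoldt i =
        ∑ d ∈ Finset.Ioc 0 M, if d ∣ n + 1 then vonMangoldt d else 0 := by
      rw [← Finset.sum_filter]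
      apply Finset.sum_congr _ (fun _ _ => rfl)
      ext d
      simp only [Nat.mem_divisors, Finset.mem_filter, Finset.mem_Ioc]
      constructor
      · rintro ⟨h1, h2⟩
        exact ⟨⟨Nat.pos_of_dvd_of_pos h1 (by omega), (Nat.le_of_dvd (by omega) h1).trans h⟩, h1⟩
      · rintro ⟨_, h1⟩
        exact ⟨h1, by omega⟩
    rw [h1, ← Finset.sum_add_distrib]
    apply Finset.sum_congr rfl
    intro d _
    rw [Nat.succ_div]
    split_ifs <;> push_cast <;> ring

lemma aux_fac_upper (m : ℕ) (hm : 1 ≤ m) :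
    Real.log (m.factorial) ≤ m * Real.log m - m + Real.log m + 1 := by
  induction m, hm using Nat.le_induction with
  | base => simp
  | succ m hm ih =>
    rw [Nat.factorial_succ, Nat.cast_mul, Real.log_mul (by positivity) (by positivity)]
    have hm0 : (0 : ℝ) < m := by exact_mod_cast hm
    have h := Real.log_le_sub_one_of_pos (x := (m : ℝ) / (m + 1)) (by positivity)
    rw [Real.log_div (by positivity) (by positivity)] at h
    have h2 : (m : ℝ) / (m + 1) - 1 = - (1 / (m + 1)) := by field_simp; ring
    rw [h2] at h
    have h3 : ((m : ℝ) + 1) * (Real.log m - Real.log (m + 1)) ≤ -1 := by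
      calc _ ≤ ((m : ℝ) + 1) * (- (1 / (m + 1))) := by gcongr
        _ = -1 := by field_simp
    push_cast
    linarith

lemma aux_G_mono (a b : ℝ) (ha : 1 ≤ a) (hab : a ≤ b) :
    a * Real.log a - a ≤ b * Real.log b - b := by
  have hb : 0 < b := by linarith
  have ha0 : 0 < a := by linarith
  have h := Real.log_le_sub_one_of_pos (x := a / b) (by positivity)
  rw [Real.log_div (by positivity) (by positivity)] at h
  have h' := Real.log_le_sub_one_of_pos (x := 1 / b) (by positivity)
  rw [Real.log_div (by positivity) (by positivity), Real.log_one] at h'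
  have h1 : 1 / b ≤ a / b := by gcongr
  have h2 : a * (Real.log a - Real.log b) ≤ a * (a / b - 1) := by gcongr
  have h3 : (b - a) * (1 - a / b) ≤ (b - a) * Real.log b := by
    apply mul_le_mul_of_nonneg_left _ (by linarith)
    linarith
  have h4 : (b - a) * (1 - a / b) + a * (1 - a / b) = b - a := by field_simp; ring
  linarith

lemma aux_T_upper (n k : ℕ) (hk : 0 < k) (hn : k ≤ n) :
    Real.log ((n / k).factorial) ≤ (n / k : ℝ) * Real.log (n / k) - n / k + Real.log n + 1 := by
  have h1 : 1 ≤ n / k := (Nat.one_le_div_iff hk).2 hn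
  have h2 : (1 : ℝ) ≤ ((n / k : ℕ) : ℝ) := by exact_mod_cast h1
  have h3 : ((n / k : ℕ) : ℝ) ≤ (n : ℝ) / k := Nat.cast_div_le
  have h4 : ((n / k : ℕ) : ℝ) ≤ n := by exact_mod_cast Nat.div_le_self n k
  have := aux_fac_upper _ h1
  have := aux_G_mono _ _ h2 h3
  have := Real.log_le_log (by linarith) h4
  linarith

lemma aux_fac_lower (m : ℕ) (hm : 1 ≤ m) :
    m * Real.log m - m ≤ Real.log (m.factorial) := by
  have h := Stirling.le_log_factorial_stirling (n := m) (by omega)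
  have h1 : 0 ≤ Real.log m := Real.log_natCast_nonneg m
  have h2 : 0 ≤ Real.log (2 * Real.pi) := Real.log_nonneg (by linarith [Real.pi_gt_three])
  linarith

lemma aux_T_lower (n k : ℕ) (hk : 0 < k) (hn : k ≤ n) :
    (n / k : ℝ) * Real.log (n / k) - n / k - Real.log (n + 1) ≤ Real.log ((n / k).factorial) := by
  have hk0 : (0 : ℝ) < k := by exact_mod_cast hk
  have h := aux_fac_lower (n / k + 1) (Nat.le_add_left 1 _)
  rw [Nat.factorial_succ, Nat.cast_mul, Real.log_mul (by positivity) (by positivity)] at h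
  have h2 : (1 : ℝ) ≤ (n : ℝ) / k := by
    rw [le_div_iff₀ hk0, one_mul]; exact_mod_cast hn
  have h3 : (n : ℝ) / k ≤ ((n / k + 1 : ℕ) : ℝ) := by
    rw [div_le_iff₀ hk0]
    have := Nat.lt_div_mul_add (a := n) hk
    have : n ≤ (n / k + 1) * k := by nlinarith
    exact_mod_cast this
  have h4 : ((n / k + 1 : ℕ) : ℝ) ≤ n + 1 := by
    push_cast
    have := Nat.div_le_self n k
    have : ((n / k : ℕ) : ℝ) ≤ n := by exact_mod_cast this
    linarith
  have := aux_G_mono _ _ h2 h3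
  have := Real.log_le_log (by linarith) h4
  linarith

noncomputable def auxF (n : ℕ) : ℝ :=
  Real.log ((n / 1).factorial) - Real.log ((n / 2).factorial) - Real.log ((n / 3).factorial)
    - Real.log ((n / 5).factorial) + Real.log ((n / 30).factorial)

def auxE (m : ℕ) : ℤ := m - (m / 2 : ℕ) - (m / 3 : ℕ) - (m / 5 : ℕ) + (m / 30 : ℕ)

lemma auxE_nonneg (m : ℕ) : 0 ≤ auxE m := by unfold auxE; omega
lemma auxE_le (m : ℕ) : auxE m ≤ 1 := by unfold auxE; omega
lemma auxE_eq (m : ℕ) (h : 1 ≤ m) (h' : m < 6) : auxE m = 1 := by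
  unfold auxE; omega

open ArithmeticFunction in
lemma auxF_eq (n : ℕ) : auxF n = ∑ d ∈ Finset.Ioc 0 n, vonMangoldt d * (auxE (n / d) : ℝ) := by
  unfold auxF
  rw [← aux_sum n (n / 1) (Nat.div_le_self _ _), ← aux_sum n (n / 2) (Nat.div_le_self _ _),
    ← aux_sum n (n / 3) (Nat.div_le_self _ _), ← aux_sum n (n / 5) (Nat.div_le_self _ _),
    ← aux_sum n (n / 30) (Nat.div_le_self _ _), ← Finset.sum_sub_distrib,
    ← Finset.sum_sub_distrib, ← Finset.sum_sub_distrib, ← Finset.sum_add_distrib]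
  apply Finset.sum_congr rfl
  intro d _
  unfold auxE
  rw [Nat.div_right_comm n 2, Nat.div_right_comm n 3, Nat.div_right_comm n 5,
    Nat.div_right_comm n 30, Nat.div_one]
  simp only [Int.cast_add, Int.cast_sub, Int.cast_natCast]
  ring

open ArithmeticFunction in
lemma auxF_le_psi (n : ℕ) : auxF n ≤ Chebyshev.psi n := by
  rw [auxF_eq, Chebyshev.psi, Nat.floor_natCast]
  apply Finset.sum_le_sum
  intro d _
  have h1 : (auxE (n / d) : ℝ) ≤ 1 := by exact_mod_cast auxE_le _
  have h2 : 0 ≤ vonMangoldt d := vonMangoldt_nonneg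
  nlinarith

open ArithmeticFunction in
lemma psi_sub_le_auxF (n : ℕ) :
    Chebyshev.psi n ≤ auxF n + Chebyshev.psi ((n / 6 : ℕ) : ℝ) := by
  have h0 : ∑ d ∈ Finset.Ioc 0 (n / 6), vonMangoldt d =
      ∑ d ∈ Finset.Ioc 0 n, if d ≤ n / 6 then vonMangoldt d else 0 := by
    rw [← Finset.sum_filter]
    apply Finset.sum_congr _ (fun _ _ => rfl)
    ext d
    simp only [Finset.mem_filter, Finset.mem_Ioc]
    omega
  rw [auxF_eq, Chebyshev.psi, Chebyshev.psi, Nat.floor_natCast, Nat.floor_natCast, h0,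
    ← Finset.sum_add_distrib]
  apply Finset.sum_le_sum
  intro d hd
  rw [Finset.mem_Ioc] at hd
  have h2 : 0 ≤ vonMangoldt d := vonMangoldt_nonneg
  have h1 : (0 : ℝ) ≤ (auxE (n / d) : ℝ) := by exact_mod_cast auxE_nonneg _
  split_ifs with h
  · nlinarith
  · rw [auxE_eq]
    · simp
    · exact (Nat.one_le_div_iff hd.1).2 hd.2
    · rw [Nat.div_lt_iff_lt_mul hd.1]
      omega

lemma aux_A : ∃ A : ℝ, 0.92 ≤ A ∧ A ≤ 0.927 ∧
    A = 7 / 15 * Real.log 2 + 3 / 10 * Real.log 3 + 1 / 6 * Real.log 5 := by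
  refine ⟨_, ?_, ?_, rfl⟩
  all_goals
    have hK : Real.log ((2 ^ 14 * 3 ^ 9 * 5 ^ 5 : ℝ) ^ 5) =
        150 * (7 / 15 * Real.log 2 + 3 / 10 * Real.log 3 + 1 / 6 * Real.log 5) := by
      rw [Real.log_pow, Real.log_mul (by positivity) (by positivity),
        Real.log_mul (by positivity) (by positivity), Real.log_pow, Real.log_pow, Real.log_pow]
      push_cast
      ring
  · have : (138 : ℝ) ≤ Real.log ((2 ^ 14 * 3 ^ 9 * 5 ^ 5 : ℝ) ^ 5) := by
      rw [Real.le_log_iff_exp_le (by positivity)]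
      have h := Real.exp_one_lt_d9.le
      have : Real.exp 138 = (Real.exp 1) ^ 138 := by rw [← Real.exp_nat_mul]; norm_num
      rw [this]
      calc _ ≤ (2.7182818286 : ℝ) ^ 138 := by gcongr
        _ ≤ _ := by norm_num
    rw [hK] at this
    linarith
  · have : Real.log ((2 ^ 14 * 3 ^ 9 * 5 ^ 5 : ℝ) ^ 5) ≤ 139 := by
      rw [Real.log_le_iff_le_exp (by positivity)]
      have h := Real.exp_one_gt_d9.le
      have : Real.exp 139 = (Real.exp 1) ^ 139 := by rw [← Real.exp_nat_mul]; norm_num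
      rw [this]
      calc _ ≤ (2.7182818283 : ℝ) ^ 139 := by norm_num
        _ ≤ _ := by gcongr
    rw [hK] at this
    linarith

lemma auxF_bounds (n : ℕ) (hn : 30 ≤ n) :
    0.92 * n - 5 * Real.log (n + 1) - 4 ≤ auxF n ∧
      auxF n ≤ 0.927 * n + 5 * Real.log (n + 1) + 4 := by
  obtain ⟨A, hA1, hA2, hA⟩ := aux_A
  have hn0 : (0 : ℝ) < n := by exact_mod_cast (by omega : 0 < n)
  have hl : Real.log n ≤ Real.log (n + 1) := Real.log_le_log hn0 (by linarith)
  have u1 := aux_T_upper n 1 (by norm_num) (by omega)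
  have u2 := aux_T_upper n 2 (by norm_num) (by omega)
  have u3 := aux_T_upper n 3 (by norm_num) (by omega)
  have u5 := aux_T_upper n 5 (by norm_num) (by omega)
  have u30 := aux_T_upper n 30 (by norm_num) (by omega)
  have l1 := aux_T_lower n 1 (by norm_num) (by omega)
  have l2 := aux_T_lower n 2 (by norm_num) (by omega)
  have l3 := aux_T_lower n 3 (by norm_num) (by omega)
  have l5 := aux_T_lower n 5 (by norm_num) (by omega)
  have l30 := aux_T_lower n 30 (by norm_num) (by omega)
  have h30 : Real.log 30 = Real.log 2 + Real.log 3 + Real.log 5 := by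
    rw [← Real.log_mul (by norm_num) (by norm_num), ← Real.log_mul (by norm_num) (by norm_num)]
    norm_num
  have e1 : Real.log ((n : ℝ) / (1 : ℕ)) = Real.log n := by simp
  have e2 : Real.log ((n : ℝ) / (2 : ℕ)) = Real.log n - Real.log 2 := by
    rw [Real.log_div (by positivity) (by positivity)]; norm_num
  have e3 : Real.log ((n : ℝ) / (3 : ℕ)) = Real.log n - Real.log 3 := by
    rw [Real.log_div (by positivity) (by positivity)]; norm_num
  have e5 : Real.log ((n : ℝ) / (5 : ℕ)) = Real.log n - Real.log 5 := by
    rw [Real.log_div (by positivity) (by positivity)]; norm_num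
  have e30 : Real.log ((n : ℝ) / (30 : ℕ)) =
      Real.log n - (Real.log 2 + Real.log 3 + Real.log 5) := by
    rw [Real.log_div (by positivity) (by positivity), ← h30]; norm_num
  rw [e1] at u1 l1
  rw [e2] at u2 l2
  rw [e3] at u3 l3
  rw [e5] at u5 l5
  rw [e30] at u30 l30
  push_cast at u1 u2 u3 u5 u30 l1 l2 l3 l5 l30
  have hAn : A * n = 7 / 15 * (n * Real.log 2) + 3 / 10 * (n * Real.log 3)
    + 1 / 6 * (n * Real.log 5) := by rw [hA]; ring
  have hAn1 : 0.92 * n ≤ A * n := by gcongr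
  have hAn2 : A * n ≤ 0.927 * n := by gcongr
  unfold auxF
  constructor
  · ring_nf at *
    linarith
  · ring_nf at *
    linarith

lemma aux_psi_upper (n : ℕ) : Chebyshev.psi n ≤ 1.2 * n + 4210 := by
  induction n using Nat.strong_induction_on with
  | _ n ih =>
    by_cases hn : n < 1000
    · have h := Chebyshev.psi_le_const_mul_self (x := n) (by positivity)
      have h4 : Real.log 4 ≤ 1.4 := by
        have : Real.log 4 = 2 * Real.log 2 := by
          rw [show (4 : ℝ) = 2 ^ 2 by norm_num, Real.log_pow]; norm_num
        linarith [Real.log_two_lt_d9]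
      have hn' : (n : ℝ) < 1000 := by exact_mod_cast hn
      have hn0 : (0 : ℝ) ≤ n := by positivity
      nlinarith
    · have hn' : (1000 : ℝ) ≤ n := by exact_mod_cast (by omega : 1000 ≤ n)
      have h1 := psi_sub_le_auxF n
      have h2 := (auxF_bounds n (by omega)).2
      have h3 := ih (n / 6) (by omega)
      have h4 : ((n / 6 : ℕ) : ℝ) ≤ (n : ℝ) / 6 := by exact_mod_cast Nat.cast_div_le
      have h5 := Real.log_le_sub_one_of_pos (x := ((n : ℝ) + 1) / 1001) (by positivity)
      rw [Real.log_div (by positivity) (by positivity)] at h5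
      have h6 : Real.log 1001 ≤ 7 := by
        rw [Real.log_le_iff_le_exp (by positivity)]
        have h := Real.exp_one_gt_d9.le
        have : Real.exp 7 = (Real.exp 1) ^ 7 := by rw [← Real.exp_nat_mul]; norm_num
        rw [this]
        calc _ ≤ (2.7182818283 : ℝ) ^ 7 := by norm_num
          _ ≤ _ := by gcongr
      linarith

def auxP (x : ℕ) : Prop := 4 ≤ ((Finset.Ioc x (3 * x / 2)).filter Nat.Prime).card

lemma auxP_large (x : ℕ) (hx : 200000 ≤ x) : auxP x := by
  by_contra hcon
  unfold auxP at hcon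
  have hx' : (200000 : ℝ) ≤ x := by exact_mod_cast hx
  obtain ⟨N, hN⟩ : ∃ N, N = 3 * x / 2 := ⟨_, rfl⟩
  rw [← hN] at hcon
  have hN1 : (N : ℝ) ≤ 3 / 2 * x := by
    have : 2 * N ≤ 3 * x := by omega
    have : (2 : ℝ) * N ≤ 3 * x := by exact_mod_cast this
    linarith
  have hN2 : 3 / 2 * x - 1 / 2 ≤ (N : ℝ) := by
    have : 3 * x ≤ 2 * N + 1 := by omega
    have : (3 : ℝ) * x ≤ 2 * N + 1 := by exact_mod_cast this
    linarith
  have h1 := (auxF_bounds N (by omega)).1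
  have h2 := auxF_le_psi N
  have h3 := Chebyshev.psi_sub_theta_le (x := N) (by linarith)
  have h4 := aux_psi_upper x
  have h5 := Chebyshev.theta_le_psi x
  have h6 : Chebyshev.theta N - Chebyshev.theta x ≤ 3 * Real.log (N + 1) := by
    have : Chebyshev.theta N = Chebyshev.theta x +
        ∑ p ∈ (Finset.Ioc x N).filter Nat.Prime, Real.log p := by
      rw [Chebyshev.theta, Chebyshev.theta, Nat.floor_natCast, Nat.floor_natCast,
        Finset.sum_filter, Finset.sum_filter, Finset.sum_filter,
        Finset.sum_Ioc_consecutive _ (by omega) (by omega)]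
    rw [this]
    have h := Finset.sum_le_card_nsmul ((Finset.Ioc x N).filter Nat.Prime)
      (fun p => Real.log (p : ℝ)) (Real.log (N + 1)) (by
        intro p hp
        rw [Finset.mem_filter, Finset.mem_Ioc] at hp
        apply Real.log_le_log
        · exact_mod_cast hp.2.pos
        · have := hp.1.2
          have : (p : ℝ) ≤ N := by exact_mod_cast this
          linarith)
    rw [nsmul_eq_mul] at h
    have hc : (((Finset.Ioc x N).filter Nat.Prime).card : ℝ) ≤ 3 := by
      exact_mod_cast (by omega : ((Finset.Ioc x N).filter Nat.Prime).card ≤ 3)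
    have hlog : 0 ≤ Real.log ((N : ℝ) + 1) := Real.log_nonneg (by linarith)
    nlinarith
  obtain ⟨s, hs⟩ : ∃ s, s = √(N : ℝ) := ⟨_, rfl⟩
  have hs2 : s * s = N := by rw [hs]; exact Real.mul_self_sqrt (by positivity)
  have hs547 : 547 ≤ s := by
    rw [hs]; apply Real.le_sqrt_of_sq_le; linarith
  have hls : Real.log N ≤ 11 + 2 * s / 547 := by
    have h := Real.log_le_sub_one_of_pos (x := s / 547) (by positivity)
    rw [Real.log_div (by positivity) (by positivity)] at h
    have h6 : Real.log (547 ^ 2) ≤ 13 := by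
      rw [Real.log_le_iff_le_exp (by positivity)]
      have h := Real.exp_one_gt_d9.le
      have : Real.exp 13 = (Real.exp 1) ^ 13 := by rw [← Real.exp_nat_mul]; norm_num
      rw [this]
      calc _ ≤ (2.7182818283 : ℝ) ^ 13 := by norm_num
        _ ≤ _ := by gcongr
    rw [Real.log_pow] at h6
    rw [← hs2, Real.log_mul (by positivity) (by positivity)]
    push_cast at h6
    linarith
  have hlN : Real.log ((N : ℝ) + 1) ≤ Real.log N + 1 := by
    have : Real.log ((N : ℝ) + 1) ≤ Real.log (N * 2) := by
      apply Real.log_le_log <;> linarith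
    rw [Real.log_mul (by linarith) (by norm_num)] at this
    linarith [Real.log_two_lt_d9]
  rw [← hs] at h3
  have h7 : 2 * s * Real.log N ≤ 2 * s * (11 + 2 * s / 547) := by gcongr
  have h8 : 2 * s * (11 + 2 * s / 547) = 22 * s + 4 / 547 * N := by rw [← hs2]; ring
  have h9 : s * 547 ≤ N := by rw [← hs2]; gcongr
  linarith

lemma auxP_step (a b c d e : ℕ)
    (h : b < c ∧ c < d ∧ d < e ∧ 2 * e ≤ 3 * a ∧ b.Prime ∧ c.Prime ∧ d.Prime ∧ e.Prime)
    (hb : ∀ x, b ≤ x → auxP x) : ∀ x, a ≤ x → auxP x := by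
  intro x hx
  by_cases hxb : b ≤ x
  · exact hb x hxb
  obtain ⟨h1, h2, h3, h4, pb, pc, pd, pe⟩ := h
  have hsub : ({b, c, d, e} : Finset ℕ) ⊆ (Finset.Ioc x (3 * x / 2)).filter Nat.Prime := by
    intro y hy
    simp only [Finset.mem_insert, Finset.mem_singleton] at hy
    rw [Finset.mem_filter, Finset.mem_Ioc]
    rcases hy with rfl | rfl | rfl | rfl
    · exact ⟨by omega, pb⟩
    · exact ⟨by omega, pc⟩
    · exact ⟨by omega, pd⟩
    · exact ⟨by omega, pe⟩
  have hcard : ({b, c, d, e} : Finset ℕ).card = 4 := by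
    rw [Finset.card_insert_of_notMem, Finset.card_insert_of_notMem,
      Finset.card_insert_of_notMem, Finset.card_singleton]
    all_goals simp only [Finset.mem_insert, Finset.mem_singleton]; omega
  unfold auxP
  rw [← hcard]
  exact Finset.card_le_card hsub

lemma auxP_all : ∀ x, 37 ≤ x → auxP x := by
  refine auxP_step 37 41 43 47 53 (by norm_num) ?_
  refine auxP_step 41 43 47 53 59 (by norm_num) ?_
  refine auxP_step 43 47 53 59 61 (by norm_num) ?_
  refine auxP_step 47 53 59 61 67 (by norm_num) ?_
  refine auxP_step 53 59 61 67 71 (by norm_num) ?_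
  refine auxP_step 59 61 67 71 73 (by norm_num) ?_
  refine auxP_step 61 67 71 73 79 (by norm_num) ?_
  refine auxP_step 67 71 73 79 83 (by norm_num) ?_
  refine auxP_step 71 73 79 83 89 (by norm_num) ?_
  refine auxP_step 73 79 83 89 97 (by norm_num) ?_
  refine auxP_step 79 83 89 97 101 (by norm_num) ?_
  refine auxP_step 83 89 97 101 103 (by norm_num) ?_
  refine auxP_step 89 97 101 103 107 (by norm_num) ?_
  refine auxP_step 97 101 103 107 109 (by norm_num) ?_
  refine auxP_step 101 103 107 109 113 (by norm_num) ?_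
  refine auxP_step 103 107 109 113 127 (by norm_num) ?_
  refine auxP_step 107 109 113 127 131 (by norm_num) ?_
  refine auxP_step 109 113 127 131 137 (by norm_num) ?_
  refine auxP_step 113 127 131 137 139 (by norm_num) ?_
  refine auxP_step 127 131 137 139 149 (by norm_num) ?_
  refine auxP_step 131 137 139 149 151 (by norm_num) ?_
  refine auxP_step 137 139 149 151 157 (by norm_num) ?_
  refine auxP_step 139 149 151 157 163 (by norm_num) ?_
  refine auxP_step 149 151 157 163 167 (by norm_num) ?_
  refine auxP_step 151 157 163 167 173 (by norm_num) ?_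
  refine auxP_step 157 163 167 173 179 (by norm_num) ?_
  refine auxP_step 163 167 173 179 193 (by norm_num) ?_
  refine auxP_step 167 173 179 193 211 (by norm_num) ?_
  refine auxP_step 173 179 193 211 229 (by norm_num) ?_
  refine auxP_step 179 193 211 229 251 (by norm_num) ?_
  refine auxP_step 193 211 229 251 271 (by norm_num) ?_
  refine auxP_step 211 229 251 271 293 (by norm_num) ?_
  refine auxP_step 229 251 271 293 317 (by norm_num) ?_
  refine auxP_step 251 271 293 317 347 (by norm_num) ?_
  refine auxP_step 271 293 317 347 379 (by norm_num) ?_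
  refine auxP_step 293 317 347 379 409 (by norm_num) ?_
  refine auxP_step 317 347 379 409 449 (by norm_num) ?_
  refine auxP_step 347 379 409 449 491 (by norm_num) ?_
  refine auxP_step 379 409 449 491 523 (by norm_num) ?_
  refine auxP_step 409 449 491 523 571 (by norm_num) ?_
  refine auxP_step 449 491 523 571 619 (by norm_num) ?_
  refine auxP_step 491 523 571 619 677 (by norm_num) ?_
  refine auxP_step 523 571 619 677 743 (by norm_num) ?_
  refine auxP_step 571 619 677 743 811 (by norm_num) ?_
  refine auxP_step 619 677 743 811 887 (by norm_num) ?_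
  refine auxP_step 677 743 811 887 971 (by norm_num) ?_
  refine auxP_step 743 811 887 971 1063 (by norm_num) ?_
  refine auxP_step 811 887 971 1063 1163 (by norm_num) ?_
  refine auxP_step 887 971 1063 1163 1279 (by norm_num) ?_
  refine auxP_step 971 1063 1163 1279 1399 (by norm_num) ?_
  refine auxP_step 1063 1163 1279 1399 1531 (by norm_num) ?_
  refine auxP_step 1163 1279 1399 1531 1669 (by norm_num) ?_
  refine auxP_step 1279 1399 1531 1669 1831 (by norm_num) ?_
  refine auxP_step 1399 1531 1669 1831 2011 (by norm_num) ?_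
  refine auxP_step 1531 1669 1831 2011 2207 (by norm_num) ?_
  refine auxP_step 1669 1831 2011 2207 2423 (by norm_num) ?_
  refine auxP_step 1831 2011 2207 2423 2663 (by norm_num) ?_
  refine auxP_step 2011 2207 2423 2663 2927 (by norm_num) ?_
  refine auxP_step 2207 2423 2663 2927 3217 (by norm_num) ?_
  refine auxP_step 2423 2663 2927 3217 3533 (by norm_num) ?_
  refine auxP_step 2663 2927 3217 3533 3881 (by norm_num) ?_
  refine auxP_step 2927 3217 3533 3881 4261 (by norm_num) ?_
  refine auxP_step 3217 3533 3881 4261 4679 (by norm_num) ?_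
  refine auxP_step 3533 3881 4261 4679 5119 (by norm_num) ?_
  refine auxP_step 3881 4261 4679 5119 5623 (by norm_num) ?_
  refine auxP_step 4261 4679 5119 5623 6173 (by norm_num) ?_
  refine auxP_step 4679 5119 5623 6173 6781 (by norm_num) ?_
  refine auxP_step 5119 5623 6173 6781 7459 (by norm_num) ?_
  refine auxP_step 5623 6173 6781 7459 8191 (by norm_num) ?_
  refine auxP_step 6173 6781 7459 8191 9007 (by norm_num) ?_
  refine auxP_step 6781 7459 8191 9007 9907 (by norm_num) ?_
  refine auxP_step 7459 8191 9007 9907 10891 (by norm_num) ?_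
  refine auxP_step 8191 9007 9907 10891 11971 (by norm_num) ?_
  refine auxP_step 9007 9907 10891 11971 13163 (by norm_num) ?_
  refine auxP_step 9907 10891 11971 13163 14479 (by norm_num) ?_
  refine auxP_step 10891 11971 13163 14479 15923 (by norm_num) ?_
  refine auxP_step 11971 13163 14479 15923 17509 (by norm_num) ?_
  refine auxP_step 13163 14479 15923 17509 19259 (by norm_num) ?_
  refine auxP_step 14479 15923 17509 19259 21179 (by norm_num) ?_
  refine auxP_step 15923 17509 19259 21179 23293 (by norm_num) ?_
  refine auxP_step 17509 19259 21179 23293 25621 (by norm_num) ?_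
  refine auxP_step 19259 21179 23293 25621 28183 (by norm_num) ?_
  refine auxP_step 21179 23293 25621 28183 30983 (by norm_num) ?_
  refine auxP_step 23293 25621 28183 30983 34061 (by norm_num) ?_
  refine auxP_step 25621 28183 30983 34061 37463 (by norm_num) ?_
  refine auxP_step 28183 30983 34061 37463 41203 (by norm_num) ?_
  refine auxP_step 30983 34061 37463 41203 45319 (by norm_num) ?_
  refine auxP_step 34061 37463 41203 45319 49843 (by norm_num) ?_
  refine auxP_step 37463 41203 45319 49843 54799 (by norm_num) ?_
  refine auxP_step 41203 45319 49843 54799 60271 (by norm_num) ?_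
  refine auxP_step 45319 49843 54799 60271 66293 (by norm_num) ?_
  refine auxP_step 49843 54799 60271 66293 72911 (by norm_num) ?_
  refine auxP_step 54799 60271 66293 72911 80191 (by norm_num) ?_
  refine auxP_step 60271 66293 72911 80191 88177 (by norm_num) ?_
  refine auxP_step 66293 72911 80191 88177 96989 (by norm_num) ?_
  refine auxP_step 72911 80191 88177 96989 106681 (by norm_num) ?_
  refine auxP_step 80191 88177 96989 106681 117331 (by norm_num) ?_
  refine auxP_step 88177 96989 106681 117331 129061 (by norm_num) ?_
  refine auxP_step 96989 106681 117331 129061 141961 (by norm_num) ?_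
  refine auxP_step 106681 117331 129061 141961 156157 (by norm_num) ?_
  refine auxP_step 117331 129061 141961 156157 171763 (by norm_num) ?_
  refine auxP_step 129061 141961 156157 171763 188939 (by norm_num) ?_
  refine auxP_step 141961 156157 171763 188939 207821 (by norm_num) ?_
  refine auxP_step 156157 171763 188939 207821 228601 (by norm_num) ?_
  refine auxP_step 171763 188939 207821 228601 251443 (by norm_num) ?_
  refine auxP_step 188939 207821 228601 251443 276587 (by norm_num) ?_
  exact fun x hx => auxP_large x (by omega)

lemma aux_nth (k : ℕ) (h : 37 ≤ Nat.nth Nat.Prime k) :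
    2 * Nat.nth Nat.Prime (k + 4) ≤ 3 * Nat.nth Nat.Prime k := by
  have hP := auxP_all _ h
  unfold auxP at hP
  obtain ⟨x, hx⟩ : ∃ x, x = Nat.nth Nat.Prime k := ⟨_, rfl⟩
  rw [← hx] at hP ⊢
  have hxp : x.Prime := by rw [hx]; exact Nat.prime_nth_prime k
  have hc : Nat.count Nat.Prime x = k := by
    rw [hx]; exact Nat.count_nth_of_infinite Nat.infinite_setOfPred_prime k
  have hc1 : Nat.count Nat.Prime (x + 1) = k + 1 := by
    rw [Nat.count_succ, hc, if_pos hxp]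
  have hlt : k + 4 < Nat.count Nat.Prime (3 * x / 2 + 1) := by
    have hd : Nat.count Nat.Prime (3 * x / 2 + 1) = Nat.count Nat.Prime (x + 1) +
        ((Finset.Ioc x (3 * x / 2)).filter Nat.Prime).card := by
      rw [Nat.count_eq_card_filter_range, Nat.count_eq_card_filter_range,
        ← Finset.card_union_of_disjoint]
      · congr 1
        ext y
        simp only [Finset.mem_filter, Finset.mem_range, Finset.mem_union, Finset.mem_Ioc]
        by_cases hy : y.Prime <;> simp only [hy, and_true, and_false, or_false] <;> omega
      · rw [Finset.disjoint_left]
        intro y h1 h2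
        simp only [Finset.mem_filter, Finset.mem_range, Finset.mem_Ioc] at h1 h2
        omega
    omega
  have := Nat.nth_lt_of_lt_count hlt
  omega

lemma aux_val (k p : ℕ) (hp : p.Prime) (h : Nat.count Nat.Prime p = k) :
    Nat.nth Nat.Prime k = p := by
  rw [← h, Nat.nth_count hp]

lemma aux_main (n : ℕ) (hn : 10 ≤ n) :
      nthPrime (n - 2) + nthPrime (n - 1) + nthPrime n >
        nthPrime (n + 1) + nthPrime (n + 2) := by
  obtain ⟨k, rfl⟩ : ∃ k, n = k + 3 := ⟨n - 3, by omega⟩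
  unfold nthPrime
  have e1 : k + 3 - 2 - 1 = k := by omega
  have e2 : k + 3 - 1 - 1 = k + 1 := by omega
  have e3 : k + 3 - 1 = k + 2 := by omega
  have e4 : k + 3 + 1 - 1 = k + 3 := by omega
  have e5 : k + 3 + 2 - 1 = k + 4 := by omega
  rw [e2, e1, e3, e4, e5]
  have v7 := aux_val 7 19 (by norm_num) (by decide +kernel)
  have v8 := aux_val 8 23 (by norm_num) (by decide +kernel)
  have v9 := aux_val 9 29 (by norm_num) (by decide +kernel)
  have v10 := aux_val 10 31 (by norm_num) (by decide +kernel)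
  have v11 := aux_val 11 37 (by norm_num) (by decide +kernel)
  have v12 := aux_val 12 41 (by norm_num) (by decide +kernel)
  have v13 := aux_val 13 43 (by norm_num) (by decide +kernel)
  have v14 := aux_val 14 47 (by norm_num) (by decide +kernel)
  by_cases hk : 11 ≤ k
  · have hm : StrictMono (Nat.nth Nat.Prime) := Nat.nth_strictMono Nat.infinite_setOfPred_prime
    have h0 : 37 ≤ Nat.nth Nat.Prime k := by rw [← v11]; exact hm.monotone hk
    have h1 := aux_nth k h0
    have h2 := hm (show k < k + 1 by omega)
    have h3 := hm (show k + 1 < k + 2 by omega)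
    have h4 := hm (show k + 3 < k + 4 by omega)
    omega
  · have : k = 7 ∨ k = 8 ∨ k = 9 ∨ k = 10 := by omega
    rcases this with rfl | rfl | rfl | rfl <;> norm_num only [v7, v8, v9, v10, v11, v12, v13, v14]

lemma aux_nine :
    nthPrime 7 + nthPrime 8 + nthPrime 9 < nthPrime 10 + nthPrime 11 := by
  unfold nthPrime
  have v6 := aux_val 6 17 (by norm_num) (by decide +kernel)
  have v7 := aux_val 7 19 (by norm_num) (by decide +kernel)
  have v8 := aux_val 8 23 (by norm_num) (by decide +kernel)
  have v9 := aux_val 9 29 (by norm_num) (by decide +kernel)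
  have v10 := aux_val 10 31 (by norm_num) (by decide +kernel)
  norm_num only [v6, v7, v8, v9, v10]

theorem three_primes_gt_two_primes :
    (∀ n : ℕ, 10 ≤ n →
      nthPrime (n - 2) + nthPrime (n - 1) + nthPrime n >
        nthPrime (n + 1) + nthPrime (n + 2)) ∧
    nthPrime 7 + nthPrime 8 + nthPrime 9 < nthPrime 10 + nthPrime 11 ∧
    IsLeast {N : ℕ | 0 < N ∧ ∀ n : ℕ, N ≤ n →
      nthPrime (n - 2) + nthPrime (n - 1) + nthPrime n >
        nthPrime (n + 1) + nthPrime (n + 2)} 10 := by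
  refine ⟨aux_main, aux_nine, ⟨by norm_num, aux_main⟩, ?_⟩
  rintro N ⟨_, hN⟩
  by_contra hlt
  have h := hN 9 (by omega)
  have h9 := aux_nine
  norm_num only at h
  omega
end
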